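/- Let G be a compact subgroup of GL(V) acting transitively on the unit sphere, for V a Euclidean space with G-invariant metric. Then the space of G-invariant translation invariant continuous 1-homogeneous valuations on V is one-dimensional, spanned by the first intrinsic volume V₁. -/

import Mathlib

open Pointwise MeasureTheory

/-- Volume of the unit ball in `ℝ^j`. -/
noncomputable def ballVol (j : ℕ) : ℝ :=
  (volume (Metric.closedBall (0 : EuclideanSpace ℝ (Fin j)) 1)).toReal

section Helpers
open Filter Topology

/-- compact convex sets (possibly empty) -/
def CC {E : Type} [NormedAddCommGroup E] [NormedSpace ℝ E] (S : Set E) : Prop :=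
  IsCompact S ∧ Convex ℝ S

section CCsec
variable {E F : Type} [NormedAddCommGroup E] [NormedSpace ℝ E]
  [NormedAddCommGroup F] [NormedSpace ℝ F]

lemma CC.add {A B : Set E} (hA : CC A) (hB : CC B) : CC (A + B) :=
  ⟨hA.1.add hB.1, hA.2.add hB.2⟩

lemma CC.smul {A : Set E} (hA : CC A) (t : ℝ) : CC (t • A) :=
  ⟨hA.1.smul t, hA.2.smul t⟩

lemma CC.inter {A B : Set E} (hA : CC A) (hB : CC B) : CC (A ∩ B) :=
  ⟨hA.1.inter hB.1, hA.2.inter hB.2⟩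

lemma CC.inter_closed {A B : Set E} (hA : CC A) (hB : IsClosed B) (hB' : Convex ℝ B) :
    CC (A ∩ B) :=
  ⟨hA.1.inter_right hB, hA.2.inter hB'⟩

lemma CC.singleton (x : E) : CC ({x} : Set E) :=
  ⟨isCompact_singleton, convex_singleton x⟩

lemma CC.empty : CC (∅ : Set E) := ⟨isCompact_empty, convex_empty⟩

lemma CC.image [FiniteDimensional ℝ E] {A : Set E} (hA : CC A) (f : E →ₗ[ℝ] F) : CC (f '' A) :=
  ⟨hA.1.image (LinearMap.continuous_of_finiteDimensional f), hA.2.linear_image f⟩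

lemma exists_mem_inter_of_union_convex {K L : Set E} (hK : CC K) (hL : CC L)
    (hU : Convex ℝ (K ∪ L)) {k l : E} (hk : k ∈ K) (hl : l ∈ L) :
    ∃ a b : ℝ, 0 ≤ a ∧ 0 ≤ b ∧ a + b = 1 ∧ a • k + b • l ∈ K ∩ L := by
  have hs : IsPreconnected (segment ℝ k l) := (convex_segment k l).isPreconnected
  rw [isPreconnected_closed_iff] at hs
  obtain ⟨x, hx, hx2⟩ := hs K L hK.1.isClosed hL.1.isClosed
    (hU.segment_subset (Or.inl hk) (Or.inr hl))
    ⟨k, left_mem_segment ℝ k l, hk⟩ ⟨l, right_mem_segment ℝ k l, hl⟩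
  obtain ⟨a, b, ha, hb, hab, rfl⟩ := hx
  exact ⟨a, b, ha, hb, hab, hx2⟩

/-- Minkowski sums distribute over intersections of sets with convex union. -/
lemma image_inter_add {K L : Set E} {B : Set F} (hK : CC K) (hL : CC L) (hB : Convex ℝ B)
    (hU : Convex ℝ (K ∪ L)) (f : E →ₗ[ℝ] F) :
    f '' (K ∩ L) + B = (f '' K + B) ∩ (f '' L + B) := by
  apply Set.Subset.antisymm
  · rintro _ ⟨_, ⟨x, hx, rfl⟩, b, hb, rfl⟩
    exact ⟨⟨_, ⟨x, hx.1, rfl⟩, b, hb, rfl⟩, ⟨_, ⟨x, hx.2, rfl⟩, b, hb, rfl⟩⟩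
  · rintro x ⟨⟨_, ⟨k, hk, rfl⟩, b, hb, h1⟩, ⟨_, ⟨l, hl, rfl⟩, b', hb', h2⟩⟩
    obtain ⟨s, t, hs, ht, hst, hm⟩ := exists_mem_inter_of_union_convex hK hL hU hk hl
    refine ⟨_, ⟨_, hm, rfl⟩, s • b + t • b', hB hb hb' hs ht hst, ?_⟩
    simp only at h1 h2 ⊢
    rw [map_add, map_smul, map_smul]
    calc s • f k + t • f l + (s • b + t • b') = s • (f k + b) + t • (f l + b') := by
          simp only [smul_add]; abel
      _ = x := by rw [h1, h2, ← add_smul, hst, one_smul]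

/-- Translation invariant valuations on compact convex sets with sublinear growth. -/
structure SubVal (ψ : Set E → ℝ) : Prop where
  empty : ψ ∅ = 0
  zero : ψ {0} = 0
  val : ∀ K L, CC K → CC L → Convex ℝ (K ∪ L) → ψ (K ∪ L) + ψ (K ∩ L) = ψ K + ψ L
  trans : ∀ K, CC K → ∀ x, ψ (K + {x}) = ψ K
  cont : ∀ K, CC K → K.Nonempty → ∀ ε > 0, ∃ δ > 0, ∀ K', CC K' → K ⊆ K' →
    K' ⊆ K + Metric.closedBall 0 δ → |ψ K' - ψ K| < ε
  growth : ∀ A B, CC A → CC B → A.Nonempty → B.Nonempty →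
    Tendsto (fun k : ℕ => ψ ((k : ℝ) • A + B) / k) atTop (𝓝 0)

lemma SubVal.pull [FiniteDimensional ℝ E] {ψ : Set F → ℝ} (h : SubVal ψ) (f : E →ₗ[ℝ] F)
    {B : Set F} (hB : CC B) (hBn : B.Nonempty) (h0 : ψ B = 0) :
    SubVal (fun S : Set E => ψ (f '' S + B)) where
  empty := by simp [h.empty]
  zero := by simp [h0]
  val := by
    intro K L hK hL hU
    rw [image_inter_add hK hL hB.2 hU, Set.image_union, Set.union_add]
    refine h.val _ _ ((hK.image f).add hB) ((hL.image f).add hB) ?_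
    rw [← Set.union_add, ← Set.image_union]
    exact (hU.linear_image f).add hB.2
  trans := by
    intro K hK x
    have : f '' (K + {x}) + B = f '' K + B + {f x} := by
      rw [Set.image_add, Set.image_singleton, add_right_comm]
    simp only [this]
    exact h.trans _ ((hK.image f).add hB) _
  cont := by
    intro K hK hKn ε hε
    obtain ⟨δ, hδ, H⟩ := h.cont _ ((hK.image f).add hB) ((hKn.image f).add hBn) ε hε
    let g : E →L[ℝ] F := LinearMap.toContinuousLinearMap f
    have hg : 0 < ‖g‖ + 1 := by positivity
    refine ⟨δ / (‖g‖ + 1), by positivity, fun K' hK' h1 h2 => ?_⟩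
    refine H _ ((hK'.image f).add hB) (Set.add_subset_add_right (Set.image_mono h1)) ?_
    rw [add_right_comm]
    refine Set.add_subset_add_right ?_
    refine (Set.image_mono h2).trans ?_
    rw [Set.image_add]
    refine Set.add_subset_add_left ?_
    rintro _ ⟨x, hx, rfl⟩
    rw [mem_closedBall_zero_iff] at hx ⊢
    calc ‖f x‖ = ‖g x‖ := rfl
      _ ≤ ‖g‖ * ‖x‖ := g.le_opNorm x
      _ ≤ (‖g‖ + 1) * (δ / (‖g‖ + 1)) := by gcongr; linarith
      _ = δ := by field_simp
  growth := by
    intro A C hA hC hAn hCn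
    have := h.growth (f '' A) (f '' C + B) (hA.image f) ((hC.image f).add hB) (hAn.image f)
      ((hCn.image f).add hBn)
    refine this.congr fun k => ?_
    congr 2
    rw [Set.image_add, image_smul_set, add_assoc]

end CCsec

/-- The chain simplex, dilated. -/
def chainSet (n : ℕ) (a : ℝ) : Set (Fin n → ℝ) :=
  {x | (∀ i, 0 ≤ x i ∧ x i ≤ a) ∧ Antitone x}

/-- vanishing in smaller dimension -/
def LowerVanish (n : ℕ) : Prop :=
  ∀ (E : Type) [NormedAddCommGroup E] [NormedSpace ℝ E] [FiniteDimensional ℝ E],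
    Module.finrank ℝ E < n → ∀ ψ : Set E → ℝ, SubVal ψ → ∀ K, CC K → ψ K = 0

section Step
variable {E : Type} [NormedAddCommGroup E] [NormedSpace ℝ E] [FiniteDimensional ℝ E]

lemma SubVal.sum_vanish {ψ : Set E → ℝ} (h : SubVal ψ) {n : ℕ} (hn : Module.finrank ℝ E = n)
    (IH : LowerVanish n) (W : Submodule ℝ E) (hW : W ≠ ⊤) {A B : Set E} (hA : CC A)
    (hAW : A ⊆ W) (hB : CC B) (hBn : B.Nonempty) (h0 : ψ B = 0) : ψ (A + B) = 0 := by
  have h1 := h.pull W.subtype hB hBn h0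
  have hfr : Module.finrank ℝ W < n := by
    rw [← hn]; exact Submodule.finrank_lt (lt_top_iff_ne_top.2 hW).ne
  have hAi : W.subtype '' (W.subtype ⁻¹' A) = A := by
    rw [Set.image_preimage_eq_iff]; simpa using hAW
  have hc : CC (W.subtype ⁻¹' A) := by
    refine ⟨?_, hA.2.linear_preimage _⟩
    exact (Submodule.closed_of_finiteDimensional W).isClosedEmbedding_subtypeVal.isCompact_preimage
      hA.1
  have := IH W hfr _ h1 _ hc
  simpa only [hAi] using this

lemma SubVal.hyper_vanish {ψ : Set E → ℝ} (h : SubVal ψ) {n : ℕ} (hn : Module.finrank ℝ E = n)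
    (IH : LowerVanish n) (f : E →ₗ[ℝ] ℝ) (hf : f ≠ 0) (c : ℝ) {A : Set E} (hA : CC A)
    (hAf : ∀ x ∈ A, f x = c) : ψ A = 0 := by
  rcases A.eq_empty_or_nonempty with rfl | ⟨x0, hx0⟩
  · exact h.empty
  have h1 := h.sum_vanish hn IH (LinearMap.ker f) (by simpa [LinearMap.ker_eq_top] using hf)
    (A := A + {-x0}) (B := {0}) (hA.add (CC.singleton _)) (by
      rintro _ ⟨x, hx, _, rfl, rfl⟩
      simp [hAf x hx, hAf x0 hx0]) (CC.singleton _) (by simp) h.zero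
  rw [Set.singleton_zero, add_zero, h.trans _ hA] at h1
  exact h1

end Step

lemma chainSet_CC (n : ℕ) (a : ℝ) : CC (chainSet n a) := by
  constructor
  · have h1 : chainSet n a = Set.Icc (fun _ => 0) (fun _ => a) ∩ {x | Antitone x} := by
      ext x
      simp only [chainSet, Set.mem_ofPred_eq, Set.mem_inter_iff, Set.mem_Icc, Pi.le_def]
      grind
    rw [h1]
    refine isCompact_Icc.inter_right ?_
    have h2 : {x : Fin n → ℝ | Antitone x} = ⋂ (i) (j) (_ : i ≤ j), {x | x j ≤ x i} := by
      ext x; simp [Antitone]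
    rw [h2]
    refine isClosed_iInter fun i => isClosed_iInter fun j => isClosed_iInter fun _ => ?_
    exact isClosed_le (continuous_apply j) (continuous_apply i)
  · rintro x ⟨hx, hx'⟩ y ⟨hy, hy'⟩ s t hs ht hst
    refine ⟨fun i => ?_, fun i j hij => ?_⟩
    · simp only [Pi.add_apply, Pi.smul_apply, smul_eq_mul]
      have := hx i; have := hy i
      constructor
      · nlinarith [mul_nonneg hs (hx i).1, mul_nonneg ht (hy i).1]
      · have h1 := mul_le_mul_of_nonneg_left (hx i).2 hs
        have h2 := mul_le_mul_of_nonneg_left (hy i).2 ht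
        have : a = s * a + t * a := by rw [← add_mul, hst, one_mul]
        linarith
    · simp only [Pi.add_apply, Pi.smul_apply, smul_eq_mul]
      have h1 := mul_le_mul_of_nonneg_left (hx' hij) hs
      have h2 := mul_le_mul_of_nonneg_left (hy' hij) ht
      linarith

lemma isCompact_coord_Icc {n : ℕ} {a : ℝ} {S : Set (Fin n → ℝ)} (h : S ⊆ Set.Icc (fun _ => 0) (fun _ => a))
    (hc : IsClosed S) : IsCompact S := isCompact_Icc.of_isClosed_subset hc h

lemma convex_coord_le {n : ℕ} (j : Fin n) (c : ℝ) : Convex ℝ {x : Fin n → ℝ | x j ≤ c} :=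
  convex_halfSpace_le (LinearMap.proj (R := ℝ) (φ := fun _ : Fin n => ℝ) j).isLinear c

lemma convex_coord_ge {n : ℕ} (j : Fin n) (c : ℝ) : Convex ℝ {x : Fin n → ℝ | c ≤ x j} :=
  convex_halfSpace_ge (LinearMap.proj (R := ℝ) (φ := fun _ : Fin n => ℝ) j).isLinear c

lemma closed_coord_le {n : ℕ} (j : Fin n) (c : ℝ) : IsClosed {x : Fin n → ℝ | x j ≤ c} :=
  isClosed_le (continuous_apply j) continuous_const

lemma closed_coord_ge {n : ℕ} (j : Fin n) (c : ℝ) : IsClosed {x : Fin n → ℝ | c ≤ x j} :=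
  isClosed_le continuous_const (continuous_apply j)

/-- partial slices -/
def chainU (n : ℕ) (a : ℝ) (j : ℕ) : Set (Fin n → ℝ) :=
  {x | x ∈ chainSet n (a + 1) ∧ ∀ i : Fin n, (i : ℕ) < j → 1 ≤ x i}

lemma chainU_CC (n : ℕ) (a : ℝ) (j : ℕ) : CC (chainU n a j) := by
  have : chainU n a j = chainSet n (a + 1) ∩ ⋂ (i : Fin n) (_ : (i : ℕ) < j), {x | 1 ≤ x i} := by
    ext x; simp [chainU]
  rw [this]
  exact (chainSet_CC n _).inter_closed
    (isClosed_iInter fun i => isClosed_iInter fun _ => closed_coord_ge i 1)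
    (convex_iInter fun i => convex_iInter fun _ => convex_coord_ge i 1)

/-- truncation to coordinates below j -/
def truncLo (n j : ℕ) : (Fin n → ℝ) →ₗ[ℝ] (Fin n → ℝ) where
  toFun x i := if (i : ℕ) < j then x i else 0
  map_add' x y := by ext i; by_cases h : (i : ℕ) < j <;> simp [h]
  map_smul' x y := by ext i; by_cases h : (i : ℕ) < j <;> simp [h]

def truncHi (n j : ℕ) : (Fin n → ℝ) →ₗ[ℝ] (Fin n → ℝ) where
  toFun x i := if (i : ℕ) < j then 0 else x i
  map_add' x y := by ext i; by_cases h : (i : ℕ) < j <;> simp [h]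
  map_smul' x y := by ext i; by_cases h : (i : ℕ) < j <;> simp [h]

lemma trunc_lt {n j : ℕ} (x y : Fin n → ℝ) {i : Fin n} (h : (i : ℕ) < j) :
    (truncLo n j x + truncHi n j y) i = x i := by
  have h1 : truncLo n j x i = x i := if_pos h
  have h2 : truncHi n j y i = 0 := if_pos h
  rw [Pi.add_apply, h1, h2, add_zero]

lemma trunc_ge {n j : ℕ} (x y : Fin n → ℝ) {i : Fin n} (h : ¬ (i : ℕ) < j) :
    (truncLo n j x + truncHi n j y) i = y i := by
  have h1 : truncLo n j x i = 0 := if_neg h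
  have h2 : truncHi n j y i = y i := if_neg h
  rw [Pi.add_apply, h1, h2, zero_add]

lemma chain_split (n : ℕ) (a : ℝ) (j : Fin n) :
    chainU n a j ∩ {x | x j ≤ 1} =
      truncLo n j '' (chainU n a j ∩ {x | x j ≤ 1}) + truncHi n j '' (chainU n a j ∩ {x | x j ≤ 1}) := by
  apply Set.Subset.antisymm
  · intro x hx
    refine ⟨_, ⟨x, hx, rfl⟩, _, ⟨x, hx, rfl⟩, ?_⟩
    ext i
    by_cases h : (i : ℕ) < j
    · exact trunc_lt x x h
    · exact trunc_ge x x h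
  · rintro _ ⟨_, ⟨x, ⟨⟨⟨hx1, hx2⟩, hx3⟩, hx4⟩, rfl⟩, _, ⟨y, ⟨⟨⟨hy1, hy2⟩, hy3⟩, hy4⟩, rfl⟩, rfl⟩
    refine ⟨⟨⟨fun i => ?_, fun i k hik => ?_⟩, fun i hi => ?_⟩, ?_⟩
    · by_cases h : (i : ℕ) < j
      · simp only [trunc_lt x y h]; exact hx1 i
      · simp only [trunc_ge x y h]; exact hy1 i
    · have hik' : (i : ℕ) ≤ k := hik
      by_cases h : (k : ℕ) < j
      · have h' : (i : ℕ) < j := lt_of_le_of_lt hik' h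
        simp only [trunc_lt x y h, trunc_lt x y h']; exact hx2 hik
      · by_cases h' : (i : ℕ) < j
        · simp only [trunc_ge x y h, trunc_lt x y h']
          have h1 := hx3 i h'
          have h2 : y k ≤ y j := hy2 (Fin.le_def.2 (not_lt.1 h))
          have h3 : y j ≤ 1 := hy4
          linarith
        · simp only [trunc_ge x y h, trunc_ge x y h']; exact hy2 hik
    · simp only [trunc_lt x y hi]; exact hx3 i hi
    · have : (truncLo n j x + truncHi n j y) j = y j := trunc_ge x y (lt_irrefl _)
      change (truncLo n j x + truncHi n j y) j ≤ 1
      rw [this]; exact hy4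

lemma chain_step {n : ℕ} (IH : LowerVanish n) {ψ : Set (Fin n → ℝ) → ℝ} (h : SubVal ψ)
    {a : ℝ} (ha : 0 ≤ a) (j : Fin n) (hj : 0 < (j : ℕ)) :
    ψ (chainU n a j ∩ {x | x j ≤ 1}) = 0 := by
  have hn : Module.finrank ℝ (Fin n → ℝ) = n := by simp
  have hR : CC (chainU n a j ∩ {x | x j ≤ 1}) :=
    (chainU_CC n a j).inter_closed (closed_coord_le _ _) (convex_coord_le _ _)
  have hne : (chainU n a j ∩ {x | x j ≤ 1}).Nonempty := by
    refine ⟨fun _ => 1, ⟨⟨fun _ => ⟨by norm_num, by simpa using ha⟩, fun _ _ _ => le_rfl⟩,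
      fun _ _ => le_rfl⟩, ?_⟩
    simp
  rw [chain_split]
  have hp : ∀ i : Fin n, (LinearMap.proj (R := ℝ) (φ := fun _ : Fin n => ℝ) i) ≠ 0 := by
    intro i h0
    have := congrArg (fun f => f (fun _ => (1 : ℝ))) h0
    simp at this
  refine h.sum_vanish hn IH (LinearMap.ker (LinearMap.proj (R := ℝ) (φ := fun _ : Fin n => ℝ) j))
    ?_ (hR.image _) ?_ (hR.image _) (hne.image _) ?_
  · rw [Ne, LinearMap.ker_eq_top]; exact hp j
  · rintro _ ⟨x, _, rfl⟩
    simp [truncLo]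
  · have hn0 : 0 < n := j.pos
    refine h.hyper_vanish hn IH _ (hp ⟨0, hn0⟩) 0 (hR.image _) ?_
    rintro _ ⟨x, _, rfl⟩
    exact if_pos (show ((⟨0, hn0⟩ : Fin n) : ℕ) < j from hj)

lemma chain_cut {n : ℕ} (IH : LowerVanish n) {ψ : Set (Fin n → ℝ) → ℝ} (h : SubVal ψ)
    (a : ℝ) (j : Fin n) :
    ψ (chainU n a j) = ψ (chainU n a (j + 1)) + ψ (chainU n a j ∩ {x | x j ≤ 1}) := by
  have hn : Module.finrank ℝ (Fin n → ℝ) = n := by simp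
  have h1 : chainU n a (j + 1) = chainU n a j ∩ {x | 1 ≤ x j} := by
    ext x
    simp only [chainU, Set.mem_ofPred_eq, Set.mem_inter_iff]
    constructor
    · rintro ⟨hx, h2⟩
      exact ⟨⟨hx, fun i hi => h2 i (by omega)⟩, h2 j (by omega)⟩
    · rintro ⟨⟨hx, h2⟩, h3⟩
      exact ⟨hx, fun i hi => le_trans h3 (hx.2 (Fin.le_def.2 (Nat.lt_succ_iff.1 hi)))⟩
  have hR : CC (chainU n a j ∩ {x | x j ≤ 1}) :=
    (chainU_CC n a j).inter_closed (closed_coord_le _ _) (convex_coord_le _ _)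
  have hun : chainU n a (j + 1) ∪ chainU n a j ∩ {x | x j ≤ 1} = chainU n a j := by
    rw [h1, ← Set.inter_union_distrib_left]
    apply Set.inter_eq_left.2
    intro x _
    exact le_total 1 (x j)
  have h2 := h.val _ _ (chainU_CC n a (j + 1)) hR (by rw [hun]; exact (chainU_CC n a j).2)
  rw [hun] at h2
  have h3 : ψ (chainU n a (j + 1) ∩ (chainU n a j ∩ {x | x j ≤ 1})) = 0 := by
    refine h.hyper_vanish hn IH (LinearMap.proj (R := ℝ) (φ := fun _ : Fin n => ℝ) j) ?_ 1
      ((chainU_CC n a (j + 1)).inter hR) ?_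
    · intro h0
      have := congrArg (fun f => f (fun _ => (1 : ℝ))) h0
      simp at this
    · rintro x ⟨hx, _, hx2⟩
      rw [h1] at hx
      exact le_antisymm hx2 hx.2
  linarith

lemma chain_add {n : ℕ} (hn : 0 < n) (IH : LowerVanish n) {ψ : Set (Fin n → ℝ) → ℝ} (h : SubVal ψ)
    {a : ℝ} (ha : 0 ≤ a) :
    ψ (chainSet n (a + 1)) = ψ (chainSet n a) + ψ (chainSet n 1) := by
  have h0 : chainU n a 0 = chainSet n (a + 1) := by ext x; simp [chainU]
  have h1 : chainU n a (0 : ℕ) ∩ {x | x (⟨0, hn⟩ : Fin n) ≤ 1} = chainSet n 1 := by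
    rw [h0]; ext x
    simp only [chainSet, Set.mem_ofPred_eq, Set.mem_inter_iff]
    constructor
    · rintro ⟨⟨h1, h2⟩, h3⟩
      exact ⟨fun i => ⟨(h1 i).1, (h2 (Fin.le_def.2 (Nat.zero_le _))).trans h3⟩, h2⟩
    · rintro ⟨h1, h2⟩
      exact ⟨⟨fun i => ⟨(h1 i).1, (h1 i).2.trans (by linarith)⟩, h2⟩, (h1 _).2⟩
  have h2 : chainU n a n = chainSet n a + {fun _ => 1} := by
    ext x
    simp only [chainU, chainSet, Set.mem_ofPred_eq, Set.add_singleton, Set.mem_image]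
    constructor
    · rintro ⟨⟨h1, h2⟩, h3⟩
      refine ⟨fun i => x i - 1, ⟨fun i => ⟨by have := h3 i i.2; linarith, by linarith [(h1 i).2]⟩,
        fun i j hij => by have := h2 hij; simp only; linarith⟩, ?_⟩
      ext i; simp
    · rintro ⟨y, ⟨h1, h2⟩, rfl⟩
      refine ⟨⟨fun i => ?_, fun i j hij => ?_⟩, fun i _ => ?_⟩
      · simp only [Pi.add_apply]; constructor <;> linarith [(h1 i).1, (h1 i).2]
      · simp only [Pi.add_apply]; linarith [h2 hij]
      · simp only [Pi.add_apply]; linarith [(h1 i).1]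
  have key : ∀ j : ℕ, j + 1 ≤ n → ψ (chainSet n (a + 1)) = ψ (chainU n a (j + 1)) + ψ (chainSet n 1) := by
    intro j
    induction j with
    | zero =>
      intro _
      have := chain_cut IH h a ⟨0, hn⟩
      simp only at this
      rw [h1, h0] at this
      exact this
    | succ j ih =>
      intro hj
      have e1 := ih (by omega)
      have e2 := chain_cut IH h a ⟨j + 1, hj⟩
      have e3 := chain_step IH h ha ⟨j + 1, hj⟩ (by simp)
      rw [e3] at e2
      simp only at e2
      linarith
  have := key (n - 1) (by omega)
  rw [Nat.sub_add_cancel hn, h2, h.trans _ (chainSet_CC n a)] at this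
  exact this

lemma chain_zero {n : ℕ} (hn : 0 < n) (IH : LowerVanish n) {ψ : Set (Fin n → ℝ) → ℝ} (h : SubVal ψ) :
    ψ (chainSet n 1) = 0 := by
  have h0 : chainSet n 0 = {0} := by
    ext x
    simp only [chainSet, Set.mem_ofPred_eq, Set.mem_singleton_iff]
    constructor
    · rintro ⟨h1, _⟩; ext i; exact le_antisymm (h1 i).2 (h1 i).1
    · rintro rfl; simp [Antitone]
  have hk : ∀ k : ℕ, ψ (chainSet n k) = k * ψ (chainSet n 1) := by
    intro k
    induction k with
    | zero => simp [h0, h.zero]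
    | succ k ih =>
      push_cast
      rw [chain_add hn IH h (Nat.cast_nonneg k), ih]; ring
  have hs : ∀ k : ℕ, 0 < k → (k : ℝ) • chainSet n 1 = chainSet n k := by
    intro k hk
    have hk' : (0 : ℝ) < k := by exact_mod_cast hk
    ext x
    rw [Set.mem_smul_set_iff_inv_smul_mem₀ hk'.ne']
    simp only [chainSet, Set.mem_ofPred_eq, Pi.smul_apply, smul_eq_mul, Antitone]
    refine and_congr (forall_congr' fun i => and_congr ?_ ?_) ?_
    · rw [mul_nonneg_iff_of_pos_left (by positivity)]
    · rw [inv_mul_le_iff₀ hk', mul_one]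
    · refine forall_congr' fun i => forall_congr' fun j => imp_congr Iff.rfl ?_
      exact mul_le_mul_iff_right₀ (by positivity)
  have hg := h.growth (chainSet n 1) {0} (chainSet_CC n 1) (CC.singleton 0)
    ⟨0, by simp [chainSet, Antitone]⟩ (by simp)
  have hc : Tendsto (fun _ : ℕ => ψ (chainSet n 1)) atTop (𝓝 0) := by
    refine hg.congr' ?_
    filter_upwards [eventually_gt_atTop 0] with k hk0
    rw [Set.singleton_zero, add_zero, hs k hk0, hk]
    have : (k : ℝ) ≠ 0 := by positivity
    field_simp
  exact tendsto_nhds_unique tendsto_const_nhds hc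

section Simplex
variable {E : Type} [NormedAddCommGroup E] [NormedSpace ℝ E]

lemma chain_mem_hull (n : ℕ) : ∀ (p : ℕ → E) (x : ℕ → ℝ), Antitone x → (∀ i, 0 ≤ x i) → x 0 ≤ 1 →
    p 0 + ∑ i ∈ Finset.range n, x i • (p (i + 1) - p i) ∈ convexHull ℝ (p '' Set.Iic n) := by
  induction n with
  | zero =>
    intro p x _ _ _
    simp only [Finset.range_zero, Finset.sum_empty, add_zero]
    exact subset_convexHull ℝ _ ⟨0, by simp, rfl⟩
  | succ n ih =>
    intro p x hx h0 h1
    rcases eq_or_lt_of_le (h0 0) with hz | hpos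
    · have : ∀ i, x i = 0 := fun i => le_antisymm ((hx (Nat.zero_le i)).trans hz.symm.le) (h0 i)
      simp only [this, zero_smul, Finset.sum_const_zero, add_zero]
      exact subset_convexHull ℝ _ ⟨0, by simp, rfl⟩
    · have h2 := ih (fun i => p (i + 1)) (fun i => x (i + 1) / x 0)
        (fun i j hij => by
          have := hx (Nat.succ_le_succ hij)
          simp only; gcongr)
        (fun i => div_nonneg (h0 _) hpos.le)
        ((div_le_one hpos).2 (hx (Nat.zero_le _)))
      have hsub : (fun i => p (i + 1)) '' Set.Iic n ⊆ p '' Set.Iic (n + 1) := by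
        rintro _ ⟨i, hi, rfl⟩
        exact ⟨i + 1, by simpa using hi, rfl⟩
      have h3 := convexHull_mono (𝕜 := ℝ) hsub h2
      have h4 : p 0 ∈ convexHull ℝ (p '' Set.Iic (n + 1)) :=
        subset_convexHull ℝ _ ⟨0, by simp, rfl⟩
      have h5 := convex_convexHull ℝ (p '' Set.Iic (n + 1)) h4 h3 (sub_nonneg.2 h1) hpos.le
        (by ring)
      convert h5 using 1
      rw [Finset.sum_range_succ', smul_add, Finset.smul_sum]
      have : ∀ i, x 0 • ((x (i + 1) / x 0) • (p (i + 1 + 1) - p (i + 1)))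
          = x (i + 1) • (p (i + 1 + 1) - p (i + 1)) := by
        intro i
        rw [smul_smul, mul_div_cancel₀ _ hpos.ne']
      simp only [this]
      module

/-- linear map for the chain simplex -/
noncomputable def chainMap (n : ℕ) (p : ℕ → E) : (Fin n → ℝ) →ₗ[ℝ] E :=
  Fintype.linearCombination ℝ (fun i : Fin n => p (i + 1) - p i)

lemma hull_eq_chain (n : ℕ) (p : ℕ → E) :
    convexHull ℝ (p '' Set.Iic n) = chainMap n p '' chainSet n 1 + {p 0} := by
  apply Set.Subset.antisymm
  · apply convexHull_min
    · rintro _ ⟨j, hj, rfl⟩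
      rw [Set.mem_Iic] at hj
      refine ⟨_, ⟨fun i => if (i : ℕ) < j then 1 else 0, ⟨fun i => ?_, fun i k hik => ?_⟩, rfl⟩, p 0, rfl, ?_⟩
      · simp only; split_ifs <;> simp
      · have : (i : ℕ) ≤ k := hik
        simp only
        split_ifs <;> first | omega | norm_num
      · simp only [chainMap, Fintype.linearCombination_apply]
        rw [Fin.sum_univ_eq_sum_range (fun i => (if i < j then (1 : ℝ) else 0) • (p (i + 1) - p i)) n]
        have h1 : ∑ i ∈ Finset.range n, (if i < j then (1 : ℝ) else 0) • (p (i + 1) - p i)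
            = ∑ i ∈ Finset.range j, (p (i + 1) - p i) := by
          rw [← Finset.sum_subset (Finset.range_mono hj)]
          · refine Finset.sum_congr rfl fun i hi => ?_
            rw [if_pos (Finset.mem_range.1 hi), one_smul]
          · intro i _ hi
            rw [if_neg (by simpa using hi), zero_smul]
        rw [h1, Finset.sum_range_sub]; abel
    · exact ((chainSet_CC n 1).2.linear_image _).add (convex_singleton _)
  · rintro _ ⟨_, ⟨x, hx, rfl⟩, _, rfl, rfl⟩
    have := chain_mem_hull n p (fun i => if h : i < n then x ⟨i, h⟩ else 0) ?_ ?_ ?_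
    · convert this using 1
      rw [Finset.sum_range]
      simp [chainMap, Fintype.linearCombination_apply, add_comm]
    · intro i j hij
      simp only
      split_ifs with h1 h2
      · exact hx.2 (Fin.le_def.2 hij)
      · omega
      · exact (hx.1 _).1
      · exact le_rfl
    · intro i
      split_ifs
      · exact (hx.1 _).1
      · exact le_rfl
    · split_ifs
      · exact (hx.1 _).2
      · exact zero_le_one

lemma hull_split {a b q : E} (S : Set E) (hq : q ∈ segment ℝ a b) :
    convexHull ℝ (insert a (insert b S)) =
      convexHull ℝ (insert a (insert q S)) ∪ convexHull ℝ (insert q (insert b S)) := by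
  have hseg : segment ℝ a b ⊆ segment ℝ a q ∪ segment ℝ q b := by
    obtain ⟨s, t, hs, ht, hst, rfl⟩ := hq
    rintro _ ⟨u, v, hu, hv, huv, rfl⟩
    rcases le_total v t with h | h
    · left
      rcases eq_or_lt_of_le ht with h0 | h0
      · have hv0 : v = 0 := by linarith
        have : u = 1 := by linarith
        subst hv0; subst this
        simpa using left_mem_segment ℝ a _
      · refine ⟨1 - v / t, v / t, sub_nonneg.2 ((div_le_one h0).2 h), by positivity, by ring, ?_⟩
        have e1 : u = 1 - v := by linarith
        have e2 : s = 1 - t := by linarith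
        subst e1; subst e2
        match_scalars <;> field_simp; ring
    · right
      rcases eq_or_lt_of_le hs with h0 | h0
      · have hv0 : u = 0 := by linarith
        have : v = 1 := by linarith
        subst hv0; subst this
        simpa using right_mem_segment ℝ _ b
      · have hus : u ≤ s := by linarith
        refine ⟨u / s, 1 - u / s, by positivity, sub_nonneg.2 ((div_le_one h0).2 hus), by ring, ?_⟩
        have e1 : v = 1 - u := by linarith
        have e2 : t = 1 - s := by linarith
        subst e1; subst e2
        match_scalars <;> field_simp; ring
  apply Set.Subset.antisymm
  · rcases S.eq_empty_or_nonempty with rfl | hS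
    · simpa [convexHull_pair] using hseg
    · rw [← Set.singleton_union (a := a), ← Set.singleton_union (a := b), ← Set.union_assoc,
        convexHull_union (by simp) hS, Set.singleton_union, convexHull_pair]
      intro x hx
      rw [mem_convexJoin] at hx
      obtain ⟨z, hz, y, hy, hx⟩ := hx
      rcases hseg hz with hz | hz
      · left
        refine (convex_convexHull ℝ _).segment_subset ?_ ?_ hx
        · refine (convex_convexHull ℝ _).segment_subset ?_ ?_ hz <;>
            apply subset_convexHull <;> simp
        · exact convexHull_mono (fun w hw => by simp [hw]) hy
      · right
        refine (convex_convexHull ℝ _).segment_subset ?_ ?_ hx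
        · refine (convex_convexHull ℝ _).segment_subset ?_ ?_ hz <;>
            apply subset_convexHull <;> simp
        · exact convexHull_mono (fun w hw => by simp [hw]) hy
  · have hq' : q ∈ convexHull ℝ (insert a (insert b S)) := by
      refine (convex_convexHull ℝ _).segment_subset ?_ ?_ hq <;>
            apply subset_convexHull <;> simp
    have hS : S ⊆ convexHull ℝ (insert a (insert b S)) :=
      fun w hw => subset_convexHull ℝ _ (by simp [hw])
    have ha : a ∈ convexHull ℝ (insert a (insert b S)) := subset_convexHull ℝ _ (by simp)
    have hb : b ∈ convexHull ℝ (insert a (insert b S)) := subset_convexHull ℝ _ (by simp)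
    apply Set.union_subset <;> apply convexHull_min _ (convex_convexHull ℝ _)
    · exact Set.insert_subset ha (Set.insert_subset hq' hS)
    · exact Set.insert_subset hq' (Set.insert_subset hb hS)

lemma SubVal.point {ψ : Set E → ℝ} (h : SubVal ψ) (x : E) : ψ {x} = 0 := by
  have := h.trans {0} (CC.singleton 0) x
  rw [h.zero] at this
  simpa using this

variable [FiniteDimensional ℝ E]

lemma SubVal.hull_vanish {ψ : Set E → ℝ} (h : SubVal ψ) {n : ℕ} (hn0 : 0 < n)
    (IH : LowerVanish n) (p : ℕ → E) : ψ (convexHull ℝ (p '' Set.Iic n)) = 0 := by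
  rw [hull_eq_chain]
  exact chain_zero hn0 IH (h.pull (chainMap n p) (CC.singleton (p 0)) (by simp) (h.point _))

lemma SubVal.finset_vanish {ψ : Set E → ℝ} (h : SubVal ψ) {n : ℕ} (hn0 : 0 < n)
    (IH : LowerVanish n) (s : Finset E) (hs : s.card ≤ n + 1) : ψ (convexHull ℝ (s : Set E)) = 0 := by
  rcases s.eq_empty_or_nonempty with rfl | ⟨x0, hx0⟩
  · simpa using h.empty
  have : (s : Set E) = (fun i : ℕ => if hi : i < s.card then (s.equivFin.symm ⟨i, hi⟩ : E) else x0) '' Set.Iic n := by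
    ext x
    constructor
    · intro hx
      refine ⟨s.equivFin ⟨x, hx⟩, ?_, ?_⟩
      · have := (s.equivFin ⟨x, hx⟩).2
        simp only [Set.mem_Iic]; omega
      · simp
    · rintro ⟨i, _, rfl⟩
      simp only
      split_ifs
      · exact Subtype.property _
      · exact hx0
  rw [this]
  exact h.hull_vanish hn0 IH _

end Simplex

section Poly
variable {E : Type} [NormedAddCommGroup E] [NormedSpace ℝ E]

/-- finite intersections of half spaces -/
def polyhedron (l : List ((E →ₗ[ℝ] ℝ) × ℝ)) : Set E := {x | ∀ h ∈ l, h.1 x ≤ h.2}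

lemma polyhedron_cons (f : (E →ₗ[ℝ] ℝ) × ℝ) (l : List ((E →ₗ[ℝ] ℝ) × ℝ)) :
    polyhedron (f :: l) = {x | f.1 x ≤ f.2} ∩ polyhedron l := by
  ext x; simp [polyhedron]

lemma polyhedron_nil : polyhedron ([] : List ((E →ₗ[ℝ] ℝ) × ℝ)) = Set.univ := by
  ext x; simp [polyhedron]

variable [FiniteDimensional ℝ E]

lemma polyhedron_closed_convex (l : List ((E →ₗ[ℝ] ℝ) × ℝ)) :
    IsClosed (polyhedron l) ∧ Convex ℝ (polyhedron l) := by
  induction l with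
  | nil => rw [polyhedron_nil]; exact ⟨isClosed_univ, convex_univ⟩
  | cons f l ih =>
    rw [polyhedron_cons]
    exact ⟨(isClosed_le (LinearMap.continuous_of_finiteDimensional f.1) continuous_const).inter ih.1,
      (convex_halfSpace_le f.1.isLinear f.2).inter ih.2⟩

lemma hull_finset_CC (s : Finset E) : CC (convexHull ℝ (s : Set E)) :=
  ⟨s.finite_toSet.isCompact_convexHull (𝕜 := ℝ), convex_convexHull ℝ _⟩

lemma cell_CC (s : Finset E) (l : List ((E →ₗ[ℝ] ℝ) × ℝ)) :
    CC (convexHull ℝ (s : Set E) ∩ polyhedron l) :=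
  (hull_finset_CC s).inter_closed (polyhedron_closed_convex l).1 (polyhedron_closed_convex l).2

lemma exists_separating (n : ℕ) (hn : Module.finrank ℝ E = n) (S : Finset E) (hS : S.card < n)
    (a b q : E) (α β : ℝ) (hα : 0 ≤ α) (hβ : 0 < β) (hαβ : α + β = 1) (hq : α • a + β • b = q) :
    ∃ g : E →ₗ[ℝ] ℝ, g ≠ 0 ∧ ∀ x ∈ convexHull ℝ (insert a (insert q (S : Set E))) ∩
      convexHull ℝ (insert q (insert b (S : Set E))), g x = g q := by
  classical
  let W : Submodule ℝ E := Submodule.span ℝ ((S.image (fun x => x - q) : Finset E) : Set E)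
  have hW : W < ⊤ := by
    rw [lt_top_iff_ne_top]
    intro h
    have h1 : Module.finrank ℝ W ≤ (S.image (fun x => x - q)).card := finrank_span_finset_le_card _
    rw [h, finrank_top, hn] at h1
    have := Finset.card_image_le (s := S) (f := fun x => x - q)
    omega
  obtain ⟨g, hg0, hg⟩ := Submodule.exists_le_ker_of_lt_top W hW
  have hgS : ∀ x ∈ S, g x = g q := by
    intro x hx
    have : x - q ∈ W := Submodule.subset_span (by
      simp only [Finset.coe_image, Set.mem_image]; exact ⟨x, hx, rfl⟩)
    have := hg this
    rw [LinearMap.mem_ker, map_sub, sub_eq_zero] at this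
    exact this
  have hgq : α * g a + β * g b = g q := by rw [← hq]; simp
  refine ⟨g, hg0, ?_⟩
  rintro x ⟨hx1, hx2⟩
  have hz : α * (g a - g q) + β * (g b - g q) = 0 := by
    linear_combination hgq - (g q) * hαβ
  rcases le_total (g q) (g a) with hga | hga
  · have hgb : g b ≤ g q := by
      by_contra hcon
      push Not at hcon
      nlinarith [mul_pos hβ (sub_pos.2 hcon), mul_nonneg hα (sub_nonneg.2 hga)]
    have h1 : convexHull ℝ (insert a (insert q (S : Set E))) ⊆ {x | g q ≤ g x} := by
      refine convexHull_min ?_ (convex_halfSpace_ge g.isLinear _)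
      refine Set.insert_subset hga (Set.insert_subset (le_refl (g q)) fun y hy => (hgS y hy).ge)
    have h2 : convexHull ℝ (insert q (insert b (S : Set E))) ⊆ {x | g x ≤ g q} := by
      refine convexHull_min ?_ (convex_halfSpace_le g.isLinear _)
      refine Set.insert_subset (le_refl (g q)) (Set.insert_subset hgb fun y hy => (hgS y hy).le)
    exact le_antisymm (h2 hx2) (h1 hx1)
  · have hgb : g q ≤ g b := by
      by_contra hcon
      push Not at hcon
      nlinarith [mul_pos hβ (sub_pos.2 hcon), mul_nonneg hα (sub_nonneg.2 hga)]
    have h1 : convexHull ℝ (insert a (insert q (S : Set E))) ⊆ {x | g x ≤ g q} := by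
      refine convexHull_min ?_ (convex_halfSpace_le g.isLinear _)
      refine Set.insert_subset hga (Set.insert_subset (le_refl (g q)) fun y hy => (hgS y hy).le)
    have h2 : convexHull ℝ (insert q (insert b (S : Set E))) ⊆ {x | g q ≤ g x} := by
      refine convexHull_min ?_ (convex_halfSpace_ge g.isLinear _)
      refine Set.insert_subset (le_refl (g q)) (Set.insert_subset hgb fun y hy => (hgS y hy).ge)
    exact le_antisymm (h1 hx1) (h2 hx2)

lemma SubVal.cell_vanish {ψ : Set E → ℝ} (h : SubVal ψ) {n : ℕ} (hn : Module.finrank ℝ E = n)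
    (hn0 : 0 < n) (IH : LowerVanish n) (l : List ((E →ₗ[ℝ] ℝ) × ℝ)) :
    ∀ s : Finset E, s.card ≤ n + 1 → ψ (convexHull ℝ (s : Set E) ∩ polyhedron l) = 0 := by
  classical
  induction l with
  | nil =>
    intro s hs
    rw [polyhedron_nil, Set.inter_univ]
    exact h.finset_vanish hn0 IH s hs
  | cons fc l ih =>
    obtain ⟨f, c⟩ := fc
    suffices H : ∀ N : ℕ, ∀ s : Finset E, s.card ≤ n + 1 → (s.filter (fun x => f x ≠ c)).card = N →
        ψ (convexHull ℝ (s : Set E) ∩ polyhedron ((f, c) :: l)) = 0 from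
      fun s hs => H _ s hs rfl
    intro N
    induction N using Nat.strong_induction_on with
    | _ N ihN =>
    intro s hs hN
    by_cases hle : ∀ x ∈ s, f x ≤ c
    · have h1 : convexHull ℝ (s : Set E) ⊆ {x | f x ≤ c} :=
        convexHull_min hle (convex_halfSpace_le f.isLinear _)
      rw [polyhedron_cons, ← Set.inter_assoc, Set.inter_eq_left.2 h1]
      exact ih s hs
    by_cases hge : ∀ x ∈ s, c ≤ f x
    · have h1 : convexHull ℝ (s : Set E) ⊆ {x | c ≤ f x} :=
        convexHull_min hge (convex_halfSpace_ge f.isLinear _)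
      have h2 : ∀ x ∈ convexHull ℝ (s : Set E) ∩ polyhedron ((f, c) :: l), f x = c := by
        rintro x ⟨hx1, hx2⟩
        rw [polyhedron_cons] at hx2
        exact le_antisymm hx2.1 (h1 hx1)
      by_cases hf : f = 0
      · subst hf
        push Not at hle
        obtain ⟨x, hx, hxc⟩ := hle
        have : convexHull ℝ (s : Set E) ∩ polyhedron (((0 : E →ₗ[ℝ] ℝ), c) :: l) = ∅ := by
          rw [Set.eq_empty_iff_forall_notMem]
          intro y hy
          have := h2 y hy
          simp at this hxc
          linarith
        rw [this, h.empty]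
      · exact h.hyper_vanish hn IH f hf c (cell_CC _ _) h2
    push Not at hle hge
    obtain ⟨a, ha, hac⟩ := hle
    obtain ⟨b, hb, hbc⟩ := hge
    have hab : a ≠ b := by rintro rfl; linarith
    set S : Finset E := (s.erase a).erase b with hSdef
    have hbS : b ∈ s.erase a := Finset.mem_erase.2 ⟨hab.symm, hb⟩
    have hsS : (s : Set E) = insert a (insert b (S : Set E)) := by
      rw [← Finset.coe_insert, ← Finset.coe_insert, hSdef, Finset.insert_erase hbS,
        Finset.insert_erase ha]
    have hScard : S.card + 2 = s.card := by
      rw [hSdef]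
      have := Finset.card_erase_add_one hbS
      have := Finset.card_erase_add_one ha
      omega
    have hd : 0 < f a - f b := by linarith
    set α : ℝ := (c - f b) / (f a - f b) with hα
    set β : ℝ := (f a - c) / (f a - f b) with hβ
    have hα0 : 0 < α := div_pos (by linarith) hd
    have hβ0 : 0 < β := div_pos (by linarith) hd
    have hαβ : α + β = 1 := by rw [hα, hβ]; field_simp; ring
    obtain ⟨q, hq⟩ : ∃ q, α • a + β • b = q := ⟨_, rfl⟩
    have hfq : f q = c := by
      rw [← hq]; simp only [map_add, map_smul, smul_eq_mul, hα, hβ]; field_simp; ring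
    have hsplit := hull_split (S : Set E) (show q ∈ segment ℝ a b from ⟨α, β, hα0.le, hβ0.le, hαβ, hq⟩)
    rw [← hsS] at hsplit
    obtain ⟨g, hg0, hg⟩ := exists_separating n hn S (by omega) a b q α β hα0.le hβ0 hαβ hq
    set s1 : Finset E := insert a (insert q S) with hs1
    set s2 : Finset E := insert q (insert b S) with hs2
    have e1 : (s1 : Set E) = insert a (insert q (S : Set E)) := by simp [hs1]
    have e2 : (s2 : Set E) = insert q (insert b (S : Set E)) := by simp [hs2]
    rw [← e1, ← e2] at hsplit hg
    have hc1 : s1.card ≤ n + 1 := by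
      have := Finset.card_insert_le a (insert q S)
      have := Finset.card_insert_le q S
      rw [hs1]; omega
    have hc2 : s2.card ≤ n + 1 := by
      have := Finset.card_insert_le q (insert b S)
      have := Finset.card_insert_le b S
      rw [hs2]; omega
    have hSs : ∀ x ∈ S, x ∈ s ∧ x ≠ a ∧ x ≠ b := by
      intro x hx
      rw [hSdef, Finset.mem_erase, Finset.mem_erase] at hx
      exact ⟨hx.2.2, hx.2.1, hx.1⟩
    have hN1 : (s1.filter (fun x => f x ≠ c)).card < N := by
      rw [← hN]
      apply Finset.card_lt_card
      rw [Finset.ssubset_iff_of_subset]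
      · refine ⟨b, by simp [hb, hbc.ne], ?_⟩
        intro hb1
        rw [Finset.mem_filter, hs1, Finset.mem_insert, Finset.mem_insert] at hb1
        rcases hb1.1 with h1 | h1 | h1
        · exact hab h1.symm
        · exact hb1.2 (h1 ▸ hfq)
        · exact (hSs b h1).2.2 rfl
      · intro x hx
        rw [Finset.mem_filter, hs1, Finset.mem_insert, Finset.mem_insert] at hx
        rw [Finset.mem_filter]
        refine ⟨?_, hx.2⟩
        rcases hx.1 with h1 | h1 | h1
        · exact h1 ▸ ha
        · exact absurd (h1 ▸ hfq) hx.2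
        · exact (hSs x h1).1
    have hN2 : (s2.filter (fun x => f x ≠ c)).card < N := by
      rw [← hN]
      apply Finset.card_lt_card
      rw [Finset.ssubset_iff_of_subset]
      · refine ⟨a, by simp [ha, hac.ne'], ?_⟩
        intro hb1
        rw [Finset.mem_filter, hs2, Finset.mem_insert, Finset.mem_insert] at hb1
        rcases hb1.1 with h1 | h1 | h1
        · exact hb1.2 (h1 ▸ hfq)
        · exact hab h1
        · exact (hSs a h1).2.1 rfl
      · intro x hx
        rw [Finset.mem_filter, hs2, Finset.mem_insert, Finset.mem_insert] at hx
        rw [Finset.mem_filter]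
        refine ⟨?_, hx.2⟩
        rcases hx.1 with h1 | h1 | h1
        · exact absurd (h1 ▸ hfq) hx.2
        · exact h1 ▸ hb
        · exact (hSs x h1).1
    have v1 := ihN _ hN1 s1 hc1 rfl
    have v2 := ihN _ hN2 s2 hc2 rfl
    have hun : convexHull ℝ (s1 : Set E) ∩ polyhedron ((f, c) :: l) ∪
        convexHull ℝ (s2 : Set E) ∩ polyhedron ((f, c) :: l) =
        convexHull ℝ (s : Set E) ∩ polyhedron ((f, c) :: l) := by
      rw [hsplit, Set.union_inter_distrib_right]
    have hv := h.val _ _ (cell_CC s1 ((f, c) :: l)) (cell_CC s2 ((f, c) :: l))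
      (by rw [hun]; exact (cell_CC s _).2)
    have hi := h.hyper_vanish hn IH g hg0 (g q) ((cell_CC s1 ((f, c) :: l)).inter (cell_CC s2 ((f, c) :: l)))
      (fun x hx => hg x ⟨hx.1.1, hx.2.1⟩)
    rw [hun, v1, v2, hi] at hv
    linarith

lemma exists_big_simplex (n : ℕ) (hn : Module.finrank ℝ E = n) (R : ℝ) :
    ∃ s : Finset E, s.card ≤ n + 1 ∧ Metric.closedBall 0 R ⊆ convexHull ℝ (s : Set E) := by
  classical
  obtain ⟨b⟩ : Nonempty (AffineBasis (Fin (n + 1)) ℝ E) :=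
    AffineBasis.exists_affineBasis_of_finiteDimensional (by simp [hn])
  have hc := b.centroid_mem_interior_convexHull
  set x0 := Finset.univ.centroid ℝ b
  rw [mem_interior_iff_mem_nhds, Metric.mem_nhds_iff] at hc
  obtain ⟨ε, hε, hball⟩ := hc
  obtain ⟨t, ht, htR⟩ : ∃ t : ℝ, 0 < t ∧ R < t * ε := by
    refine ⟨(|R| + 1) / ε, by positivity, ?_⟩
    rw [div_mul_cancel₀ _ hε.ne']
    linarith [le_abs_self R]
  refine ⟨Finset.univ.image (fun i => t • (b i - x0)), ?_, ?_⟩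
  · exact Finset.card_image_le.trans (by simp)
  · intro y hy
    rw [mem_closedBall_zero_iff] at hy
    have h1 : x0 + t⁻¹ • y ∈ convexHull ℝ (Set.range b) := by
      apply hball
      rw [Metric.mem_ball, dist_eq_norm, add_sub_cancel_left, norm_smul, norm_inv,
        Real.norm_of_nonneg ht.le, inv_mul_lt_iff₀ ht]
      linarith
    let A : E →ᵃ[ℝ] E := (t • (AffineMap.id ℝ E - AffineMap.const ℝ E x0))
    have h2 : A (x0 + t⁻¹ • y) ∈ A '' convexHull ℝ (Set.range b) := ⟨_, h1, rfl⟩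
    rw [AffineMap.image_convexHull] at h2
    have h3 : A (x0 + t⁻¹ • y) = y := by
      simp [A, smul_smul, ht.ne']
    have h4 : A '' Set.range b = ((Finset.univ.image (fun i => t • (b i - x0)) : Finset E) : Set E) := by
      rw [← Set.range_comp]
      simp [A, Function.comp_def]
    rw [h3, h4] at h2
    exact h2

lemma exists_cell_approx (n : ℕ) (hn : Module.finrank ℝ E = n) {K : Set E} (hK : CC K)
    {δ : ℝ} (hδ : 0 < δ) : ∃ (s : Finset E) (l : List ((E →ₗ[ℝ] ℝ) × ℝ)), s.card ≤ n + 1 ∧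
      K ⊆ convexHull ℝ (s : Set E) ∩ polyhedron l ∧
      convexHull ℝ (s : Set E) ∩ polyhedron l ⊆ K + Metric.closedBall 0 δ := by
  obtain ⟨R, hR⟩ := hK.1.isBounded.subset_closedBall 0
  obtain ⟨s, hs, hsR⟩ := exists_big_simplex (E := E) n hn R
  have hZ : IsCompact (convexHull ℝ (s : Set E) \ (K + Metric.ball 0 δ)) :=
    (hull_finset_CC s).1.diff Metric.isOpen_ball.add_left
  have hsep : ∀ x : E, ∃ (f : E →L[ℝ] ℝ) (c : ℝ), (∀ k ∈ K, f k ≤ c) ∧ (x ∉ K + Metric.ball 0 δ → c < f x) := by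
    intro x
    by_cases hx : x ∈ K + Metric.ball 0 δ
    · exact ⟨0, 0, by simp, fun h => absurd hx h⟩
    · have hxK : x ∉ K := fun h => hx ⟨x, h, 0, by simpa using hδ, by simp⟩
      obtain ⟨f, u, h1, h2⟩ := geometric_hahn_banach_closed_point hK.2 hK.1.isClosed hxK
      exact ⟨f, u, fun k hk => (h1 k hk).le, fun _ => h2⟩
  choose f c hfc hfx using hsep
  obtain ⟨t, ht⟩ := hZ.elim_finite_subcover (fun x => {y | c x < f x y})
    (fun x => isOpen_lt continuous_const (f x).continuous)
    (fun x hx => Set.mem_iUnion.2 ⟨x, hfx x hx.2⟩)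
  refine ⟨s, t.toList.map (fun x => ((f x : E →ₗ[ℝ] ℝ), c x)), hs, ?_, ?_⟩
  · intro k hk
    refine ⟨hsR (hR hk), ?_⟩
    intro h hh
    rw [List.mem_map] at hh
    obtain ⟨x, _, rfl⟩ := hh
    exact hfc x k hk
  · rintro x ⟨hx1, hx2⟩
    by_contra hcon
    have hx3 : x ∈ convexHull ℝ (s : Set E) \ (K + Metric.ball 0 δ) :=
      ⟨hx1, fun h => hcon (Set.add_subset_add_left Metric.ball_subset_closedBall h)⟩
    have := ht hx3
    simp only [Set.mem_iUnion] at this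
    obtain ⟨y, hy, hxy⟩ := this
    have := hx2 ((f y : E →ₗ[ℝ] ℝ), c y) (List.mem_map.2 ⟨y, by simpa using hy, rfl⟩)
    exact absurd hxy (not_lt.2 this)

end Poly

theorem lowerVanish_all (n : ℕ) : LowerVanish n := by
  induction n with
  | zero => intro E _ _ _ h; omega
  | succ n ih =>
    intro E _ _ _ hE ψ h K hK
    rcases Nat.lt_succ_iff_lt_or_eq.1 hE with hlt | hn
    · exact ih E hlt ψ h K hK
    rcases K.eq_empty_or_nonempty with rfl | hne
    · exact h.empty
    rcases Nat.eq_zero_or_pos n with h0 | hpos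
    · rw [h0] at hn
      have := Module.finrank_zero_iff.1 hn
      obtain ⟨x, hx⟩ := hne
      have : K = {x} := Set.eq_singleton_iff_unique_mem.2 ⟨hx, fun y _ => Subsingleton.elim _ _⟩
      rw [this]; exact h.point x
    by_contra hcon
    obtain ⟨δ, hδ, H⟩ := h.cont K hK hne |ψ K| (abs_pos.2 hcon)
    obtain ⟨s, l, hs, h1, h2⟩ := exists_cell_approx n hn hK hδ
    have := H _ (cell_CC s l) h1 h2
    rw [h.cell_vanish hn hpos ih l s hs] at this
    simp at this

theorem SubVal.vanish {E : Type} [NormedAddCommGroup E] [NormedSpace ℝ E] [FiniteDimensional ℝ E]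
    {ψ : Set E → ℝ} (h : SubVal ψ) {K : Set E} (hK : CC K) : ψ K = 0 :=
  lowerVanish_all (Module.finrank ℝ E + 1) E (Nat.lt_succ_self _) ψ h K hK

section OneValSec
variable {E : Type} [NormedAddCommGroup E] [NormedSpace ℝ E]

/-- one-homogeneous translation invariant continuous valuation, on sets. -/
structure OneVal (Φ : Set E → ℝ) : Prop where
  empty : Φ ∅ = 0
  zero : Φ {0} = 0
  val : ∀ K L, CC K → CC L → Convex ℝ (K ∪ L) → Φ (K ∪ L) + Φ (K ∩ L) = Φ K + Φ L
  trans : ∀ K, CC K → ∀ x, Φ (K + {x}) = Φ K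
  homog : ∀ K, CC K → K.Nonempty → ∀ t : ℝ, 0 < t → Φ (t • K) = t * Φ K
  cont : ∀ K, CC K → K.Nonempty → ∀ ε > 0, ∃ δ > 0, ∀ K', CC K' → K'.Nonempty →
    K ⊆ K' + Metric.closedBall 0 δ → K' ⊆ K + Metric.closedBall 0 δ → |Φ K' - Φ K| < ε

lemma OneVal.sub_smul {Φ Ψ : Set E → ℝ} (h : OneVal Φ) (h' : OneVal Ψ) (c : ℝ) :
    OneVal (fun S => Φ S - c * Ψ S) where
  empty := by simp [h.empty, h'.empty]
  zero := by simp [h.zero, h'.zero]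
  val := fun K L hK hL hU => by
    have h1 := h.val K L hK hL hU
    have h2 := h'.val K L hK hL hU
    linear_combination h1 - c * h2
  trans := fun K hK x => by rw [h.trans K hK, h'.trans K hK]
  homog := fun K hK hne t ht => by rw [h.homog K hK hne t ht, h'.homog K hK hne t ht]; ring
  cont := fun K hK hne ε hε => by
    obtain ⟨d1, hd1, H1⟩ := h.cont K hK hne (ε / 2) (by positivity)
    obtain ⟨d2, hd2, H2⟩ := h'.cont K hK hne (ε / (2 * (|c| + 1))) (by positivity)
    refine ⟨min d1 d2, lt_min hd1 hd2, fun K' hK' hne' s1 s2 => ?_⟩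
    have e1 := H1 K' hK' hne'
      (s1.trans (Set.add_subset_add_left (Metric.closedBall_subset_closedBall (min_le_left _ _))))
      (s2.trans (Set.add_subset_add_left (Metric.closedBall_subset_closedBall (min_le_left _ _))))
    have e2 := H2 K' hK' hne'
      (s1.trans (Set.add_subset_add_left (Metric.closedBall_subset_closedBall (min_le_right _ _))))
      (s2.trans (Set.add_subset_add_left (Metric.closedBall_subset_closedBall (min_le_right _ _))))
    have e3 : |c| * |Ψ K' - Ψ K| ≤ ε / 2 := by
      calc |c| * |Ψ K' - Ψ K| ≤ (|c| + 1) * (ε / (2 * (|c| + 1))) := by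
            gcongr; linarith
        _ = ε / 2 := by field_simp
    calc |Φ K' - c * Ψ K' - (Φ K - c * Ψ K)| = |(Φ K' - Φ K) - c * (Ψ K' - Ψ K)| := by
          congr 1; ring
      _ ≤ |Φ K' - Φ K| + |c * (Ψ K' - Ψ K)| := abs_sub _ _
      _ < ε := by rw [abs_mul]; linarith

lemma OneVal.tendsto {Φ : Set E → ℝ} (h : OneVal Φ) {A C : Set E} (hA : CC A) (hC : CC C)
    (hA' : A.Nonempty) (hC' : C.Nonempty) :
    Tendsto (fun k : ℕ => Φ (A + (1 / (k : ℝ)) • C)) atTop (𝓝 (Φ A)) := by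
  rw [Metric.tendsto_atTop]
  intro ε hε
  obtain ⟨δ, hδ, H⟩ := h.cont A hA hA' ε hε
  obtain ⟨R, hR⟩ := hC.1.isBounded.exists_norm_le
  obtain ⟨N, hN⟩ := exists_nat_gt (R / δ)
  refine ⟨N + 1, fun k hk => ?_⟩
  have hk0 : (0 : ℝ) < k := by exact_mod_cast (by omega : 0 < k)
  have hkN : (N : ℝ) ≤ k := by exact_mod_cast (by omega : N ≤ k)
  have hb : ∀ c ∈ C, ‖(1 / (k : ℝ)) • c‖ ≤ δ := by
    intro c hc
    rw [norm_smul, Real.norm_eq_abs, abs_of_pos (by positivity), one_div, inv_mul_le_iff₀ hk0]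
    have := hR c hc
    have h2 : R < N * δ := by rwa [div_lt_iff₀ hδ] at hN
    nlinarith
  rw [Real.dist_eq]
  apply H _ (hA.add (hC.smul _)) (hA'.add (hC'.smul_set))
  · obtain ⟨c, hc⟩ := hC'
    intro a ha
    refine ⟨a + (1 / (k : ℝ)) • c, ⟨a, ha, _, ⟨c, hc, rfl⟩, rfl⟩, -((1 / (k : ℝ)) • c), ?_, by simp⟩
    rw [mem_closedBall_zero_iff, norm_neg]; exact hb c hc
  · apply Set.add_subset_add_left
    rintro _ ⟨c, hc, rfl⟩
    rw [mem_closedBall_zero_iff]; exact hb c hc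

open Classical in
lemma OneVal.add [FiniteDimensional ℝ E] {Φ : Set E → ℝ} (h : OneVal Φ) {K L : Set E} (hK : CC K) (hL : CC L)
    (hK' : K.Nonempty) (hL' : L.Nonempty) : Φ (K + L) = Φ K + Φ L := by
  have key : SubVal (fun S : Set E => Φ (S + L) - Φ S - (if S.Nonempty then Φ L else 0)) := by
    refine ⟨?_, ?_, ?_, ?_, ?_, ?_⟩
    · simp [h.empty]
    · simp [h.zero]
    · intro A B hA hB hU
      rcases A.eq_empty_or_nonempty with rfl | hA'
      · simp [h.empty]
      rcases B.eq_empty_or_nonempty with rfl | hB'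
      · simp [h.empty]
      obtain ⟨x, hx⟩ := hA'
      obtain ⟨y, hy⟩ := hB'
      obtain ⟨a, b, _, _, _, hm⟩ := exists_mem_inter_of_union_convex hA hB hU hx hy
      have n1 : (A ∩ B).Nonempty := ⟨_, hm⟩
      have n2 : (A ∪ B).Nonempty := ⟨x, Or.inl hx⟩
      have nA : A.Nonempty := ⟨x, hx⟩
      have nB : B.Nonempty := ⟨y, hy⟩
      simp only [n1, n2, nA, nB, if_true]
      have e1 := h.val A B hA hB hU
      have e2 : (A ∩ B) + L = (A + L) ∩ (B + L) := by
        simpa using image_inter_add hA hB hL.2 hU (LinearMap.id : E →ₗ[ℝ] E)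
      have e3 : (A ∪ B) + L = (A + L) ∪ (B + L) := Set.union_add
      have e4 := h.val (A + L) (B + L) (hA.add hL) (hB.add hL) (by rw [← e3]; exact hU.add hL.2)
      rw [e2, e3]
      linarith
    · intro A hA x
      have : A + {x} + L = A + L + {x} := by abel
      have h3 : (A + {x}).Nonempty ↔ A.Nonempty := by rw [Set.add_nonempty]; simp
      rw [this, h.trans _ (hA.add hL), h.trans _ hA]
      simp only [h3]
    · intro A hA hA' ε hε
      obtain ⟨d1, hd1, H1⟩ := h.cont (A + L) (hA.add hL) (hA'.add hL') (ε / 2) (by positivity)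
      obtain ⟨d2, hd2, H2⟩ := h.cont A hA hA' (ε / 2) (by positivity)
      refine ⟨min d1 d2, lt_min hd1 hd2, fun A' hcA s1 s2 => ?_⟩
      have nA' : A'.Nonempty := hA'.mono s1
      simp only [hA', nA', if_true]
      have z : ∀ (δ : ℝ), 0 < δ → ∀ S : Set E, S ⊆ S + Metric.closedBall 0 δ := fun δ hδ S =>
        Set.subset_add_left S (by simp [hδ.le])
      have e1 := H1 (A' + L) (hcA.add hL) (nA'.add hL')
        ((Set.add_subset_add_right s1).trans (z d1 hd1 _)) (by
          refine (Set.add_subset_add_right (s2.trans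
            (Set.add_subset_add_left (Metric.closedBall_subset_closedBall (min_le_left d1 d2))))).trans (le_of_eq ?_)
          abel)
      have e2 := H2 A' hcA nA' (s1.trans (z d2 hd2 _)) (s2.trans
            (Set.add_subset_add_left (Metric.closedBall_subset_closedBall (min_le_right d1 d2))))
      rw [abs_lt] at e1 e2 ⊢
      constructor <;> linarith
    · intro A B hA hB hA' hB'
      have t1 := h.tendsto hA (hB.add hL) hA' (hB'.add hL')
      have t2 := h.tendsto hA hB hA' hB'
      have t3 : Tendsto (fun k : ℕ => Φ L / (k : ℝ)) atTop (𝓝 0) :=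
        tendsto_const_div_atTop_nhds_zero_nat _
      have t4 := (t1.sub t2).sub t3
      simp only [sub_self] at t4
      refine t4.congr' ?_
      filter_upwards [eventually_gt_atTop 0] with k hk
      have hk0 : (0 : ℝ) < k := by exact_mod_cast hk
      have q : ∀ C : Set E, (k : ℝ) • A + C = (k : ℝ) • (A + (1 / (k : ℝ)) • C) := by
        intro C
        rw [smul_add, smul_smul, mul_one_div_cancel hk0.ne', one_smul]
      have n1 : ((k : ℝ) • A + B).Nonempty := (hA'.smul_set).add hB'
      simp only [n1, if_true]
      rw [add_assoc, q (B + L), q B, h.homog _ (hA.add ((hB.add hL).smul _)) (hA'.add (hB'.add hL').smul_set) _ hk0,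
        h.homog _ (hA.add (hB.smul _)) (hA'.add hB'.smul_set) _ hk0]
      field_simp
  have := key.vanish hK
  simp only [hK', if_true] at this
  linarith
end OneValSec

section AvgSec
variable {E : Type} [NormedAddCommGroup E] [InnerProductSpace ℝ E] [FiniteDimensional ℝ E]

lemma ball_subset_of_support {L : Set E} (hL : CC L) {M δ : ℝ} (hδ : 0 ≤ δ) (hM : 0 ≤ M)
    (hne : L.Nonempty)
    (h : ∀ u : E, ‖u‖ = 1 → ∃ x ∈ L, M - δ ≤ inner ℝ u x) :
    Metric.closedBall 0 M ⊆ L + Metric.closedBall 0 δ := by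
  intro p hp
  by_contra hcon
  have hC : CC (L + Metric.closedBall (0 : E) δ) :=
    hL.add ⟨isCompact_closedBall _ _, convex_closedBall _ _⟩
  obtain ⟨f, s, h1, h2⟩ := geometric_hahn_banach_closed_point hC.2 hC.1.isClosed hcon
  set w := (InnerProductSpace.toDual ℝ E).symm f with hw
  have hf : ∀ x, f x = inner ℝ w x := fun x => by
    rw [hw, InnerProductSpace.toDual_symm_apply]
  have hw0 : w ≠ 0 := by
    intro h0
    obtain ⟨x, hx⟩ := hne
    have := h1 x (Set.subset_add_left L (by simp [hδ]) hx)
    rw [hf, h0, inner_zero_left] at this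
    rw [hf, h0, inner_zero_left] at h2
    linarith
  have hwn : 0 < ‖w‖ := norm_pos_iff.2 hw0
  obtain ⟨x, hx, hxM⟩ := h (‖w‖⁻¹ • w) (by rw [norm_smul, norm_inv, norm_norm, inv_mul_cancel₀ hwn.ne'])
  have h3 := h1 (x + (δ * ‖w‖⁻¹) • w) ⟨x, hx, _, by
    rw [mem_closedBall_zero_iff, norm_smul, Real.norm_eq_abs, abs_of_nonneg (by positivity)]
    rw [mul_assoc, inv_mul_cancel₀ hwn.ne', mul_one], rfl⟩
  rw [hf, inner_add_right, inner_smul_right, real_inner_self_eq_norm_sq] at h3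
  rw [real_inner_smul_left] at hxM
  have h4 : inner ℝ w p ≤ ‖w‖ * M := (real_inner_le_norm w p).trans (by
    rw [mem_closedBall_zero_iff] at hp; gcongr)
  rw [hf] at h2
  have h5 : δ * ‖w‖⁻¹ * ‖w‖ ^ 2 = δ * ‖w‖ := by field_simp
  have h6 : (M - δ) * ‖w‖ ≤ inner ℝ w x := by
    calc (M - δ) * ‖w‖ ≤ (‖w‖⁻¹ * inner ℝ w x) * ‖w‖ := by gcongr
      _ = inner ℝ w x := by field_simp
  nlinarith

lemma averaging [Nontrivial E] (G : Subgroup (E ≃ₗᵢ[ℝ] E))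
    (htrans : ∀ x y : E, ‖x‖ = 1 → ‖y‖ = 1 → ∃ g ∈ G, g x = y)
    (𝒜 : Set E → Prop) (hcc : ∀ L, 𝒜 L → CC L) (hne : ∀ L, 𝒜 L → L.Nonempty)
    (hav : ∀ L, 𝒜 L → ∀ s : Finset (E ≃ₗᵢ[ℝ] E), s.Nonempty → (∀ g ∈ s, g ∈ G) →
      𝒜 ((s.card : ℝ)⁻¹ • ∑ g ∈ s, g '' L))
    (K : Set E) (hK : 𝒜 K) :
    ∃ r : ℝ, 0 ≤ r ∧ ∀ δ > 0, ∃ L, 𝒜 L ∧ L ⊆ Metric.closedBall 0 (r + δ) ∧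
      Metric.closedBall 0 r ⊆ L + Metric.closedBall 0 δ := by
  classical
  set T : Set ℝ := {r | ∃ L, 𝒜 L ∧ L ⊆ Metric.closedBall 0 r} with hT
  have hTlb : ∀ r ∈ T, 0 ≤ r := by
    rintro r ⟨L, hL, hLr⟩
    obtain ⟨x, hx⟩ := hne L hL
    have := hLr hx
    rw [mem_closedBall_zero_iff] at this
    exact (norm_nonneg x).trans this
  have hTbdd : BddBelow T := ⟨0, hTlb⟩
  have hTne : T.Nonempty := by
    obtain ⟨R, hR⟩ := (hcc K hK).1.isBounded.subset_closedBall 0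
    exact ⟨R, K, hK, hR⟩
  set r := sInf T with hr
  have hr0 : 0 ≤ r := le_csInf hTne hTlb
  refine ⟨r, hr0, fun δ hδ => ?_⟩
  have hρ : 0 < δ / (2 * (r + 1)) := by positivity
  obtain ⟨t, htsub, htfin, htcov⟩ := (isCompact_sphere (0 : E) 1).elim_finite_subcover_image
    (b := Metric.sphere (0 : E) 1) (c := fun c => Metric.ball c (δ / (2 * (r + 1))))
    (fun _ _ => Metric.isOpen_ball) (fun x hx => Set.mem_biUnion hx (Metric.mem_ball_self hρ))
  lift t to Finset E using htfin
  obtain ⟨e0, he0⟩ : ∃ e : E, ‖e‖ = 1 := by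
    obtain ⟨x, hx⟩ := exists_ne (0 : E)
    exact ⟨‖x‖⁻¹ • x, by rw [norm_smul, norm_inv, norm_norm, inv_mul_cancel₀ (norm_ne_zero_iff.2 hx)]⟩
  have htne : t.Nonempty := by
    have := htcov (a := e0) (by simp [he0])
    simp only [Set.mem_iUnion] at this
    obtain ⟨c, hc, _⟩ := this
    exact ⟨c, by simpa using hc⟩
  have hNpos : (0 : ℝ) < t.card := by exact_mod_cast htne.card_pos
  set η := min δ (min 1 (δ / (2 * t.card))) with hη
  have hηpos : 0 < η := by positivity
  obtain ⟨M, ⟨L, hL, hLM⟩, hMη⟩ := exists_lt_of_csInf_lt hTne (lt_add_of_pos_right r hηpos)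
  have hrM : r ≤ M := csInf_le hTbdd ⟨L, hL, hLM⟩
  have hη1 : η ≤ δ := min_le_left _ _
  have hη2 : η ≤ 1 := (min_le_right _ _).trans (min_le_left _ _)
  have hη3 : η ≤ δ / (2 * t.card) := (min_le_right _ _).trans (min_le_right _ _)
  have hM0 : 0 ≤ M := hr0.trans hrM
  refine ⟨L, hL, hLM.trans (Metric.closedBall_subset_closedBall (by linarith)), ?_⟩
  refine (Metric.closedBall_subset_closedBall hrM).trans ?_
  apply ball_subset_of_support (hcc L hL) hδ.le hM0 (hne L hL)
  by_contra! hbad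
  obtain ⟨u0, hu0, hbad⟩ := hbad
  have hex : ∀ c : E, ∃ g : E ≃ₗᵢ[ℝ] E, g ∈ G ∧ (‖c‖ = 1 → g u0 = c) := by
    intro c
    by_cases hc : ‖c‖ = 1
    · obtain ⟨g, hg, hgc⟩ := htrans u0 c hu0 hc
      exact ⟨g, hg, fun _ => hgc⟩
    · exact ⟨1, G.one_mem, fun h => absurd h hc⟩
  choose γ hγG hγ using hex
  set s := t.image γ with hs
  have hsne : s.Nonempty := htne.image _
  have hscard : (s.card : ℝ) ≤ t.card := by exact_mod_cast Finset.card_image_le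
  have hspos : (0 : ℝ) < s.card := by exact_mod_cast hsne.card_pos
  have hL' := hav L hL s hsne (by
    intro g hg
    obtain ⟨c, _, rfl⟩ := Finset.mem_image.1 hg
    exact hγG c)
  have hbound : ∀ y ∈ ((s.card : ℝ)⁻¹ • ∑ g ∈ s, g '' L), ∀ u : E, ‖u‖ = 1 →
      inner ℝ u y ≤ M - δ / (2 * t.card) := by
    rintro _ ⟨z, hz, rfl⟩ u hu
    obtain ⟨x, hx, rfl⟩ := (Set.mem_finsetSum _ _ _).1 hz
    have hcov := htcov (a := u) (by simp [hu])
    simp only [Set.mem_iUnion] at hcov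
    obtain ⟨c, hc, huc⟩ := hcov
    have hct : c ∈ t := by simpa using hc
    have hc1 : ‖c‖ = 1 := by simpa using htsub hc
    have hgs : γ c ∈ s := Finset.mem_image_of_mem γ hct
    have hall : ∀ g ∈ s, inner ℝ u (x g) ≤ M := by
      intro g hg
      obtain ⟨l, hl, hle⟩ := hx hg
      have h1 := hLM hl
      rw [mem_closedBall_zero_iff] at h1
      calc inner ℝ u (x g) ≤ ‖u‖ * ‖x g‖ := real_inner_le_norm _ _
        _ = ‖l‖ := by rw [hu, one_mul, ← hle]; exact g.norm_map l
        _ ≤ M := h1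
    have hone : inner ℝ u (x (γ c)) ≤ M - δ / 2 := by
      obtain ⟨l, hl, hle⟩ := hx hgs
      have h1 := hLM hl
      rw [mem_closedBall_zero_iff] at h1
      have h2 : inner ℝ u (x (γ c)) = inner ℝ (u - c) (x (γ c)) + inner ℝ u0 l := by
        rw [inner_sub_left, ← hle]
        have : inner ℝ c ((γ c) l) = inner ℝ u0 l := by
          have hq := (γ c).inner_map_map u0 l
          rwa [hγ c hc1] at hq
        rw [← this]; simp
      have h3 : inner ℝ (u - c) (x (γ c)) ≤ δ / 2 := by
        calc inner ℝ (u - c) (x (γ c)) ≤ ‖u - c‖ * ‖x (γ c)‖ := real_inner_le_norm _ _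
          _ ≤ (δ / (2 * (r + 1))) * (r + 1) := by
              have : ‖x (γ c)‖ = ‖l‖ := by rw [← hle]; exact (γ c).norm_map l
              rw [this]
              have h5 : ‖u - c‖ ≤ δ / (2 * (r + 1)) := by
                rw [← dist_eq_norm]; exact (Metric.mem_ball.1 huc).le
              gcongr
              linarith
          _ = δ / 2 := by field_simp
      have h4 := hbad l hl
      linarith
    rw [inner_smul_right, inner_sum]
    have hsum : ∑ g ∈ s, inner ℝ u (x g) ≤ s.card * M - δ / 2 := by
      rw [← Finset.add_sum_erase s _ hgs]
      have : ∑ g ∈ s.erase (γ c), inner ℝ u (x g) ≤ (s.erase (γ c)).card • M :=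
        Finset.sum_le_card_nsmul _ _ _ (fun g hg => hall g (Finset.mem_of_mem_erase hg))
      rw [Finset.card_erase_of_mem hgs, nsmul_eq_mul, Nat.cast_pred hsne.card_pos] at this
      linarith
    calc (s.card : ℝ)⁻¹ * ∑ g ∈ s, inner ℝ u (x g) ≤ (s.card : ℝ)⁻¹ * (s.card * M - δ / 2) := by gcongr
      _ = M - δ / (2 * s.card) := by field_simp
      _ ≤ M - δ / (2 * t.card) := by gcongr
  have hmem : M - δ / (2 * t.card) ∈ T := by
    refine ⟨_, hL', fun y hy => ?_⟩
    rw [mem_closedBall_zero_iff]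
    by_cases hy0 : y = 0
    · have := hbound y hy e0 he0
      rw [hy0] at this ⊢
      simpa using this
    · have hyn := norm_ne_zero_iff.2 hy0
      have := hbound y hy (‖y‖⁻¹ • y) (by rw [norm_smul, norm_inv, norm_norm, inv_mul_cancel₀ hyn])
      rw [real_inner_smul_left, real_inner_self_eq_norm_sq] at this
      calc ‖y‖ = ‖y‖⁻¹ * ‖y‖ ^ 2 := by field_simp
        _ ≤ _ := this
  have := csInf_le hTbdd hmem
  linarith

lemma OneVal.sum_image {Φ : Set E → ℝ} (h : OneVal Φ) {L : Set E} (hL : CC L)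
    (hL' : L.Nonempty) (s : Finset (E ≃ₗᵢ[ℝ] E)) (hs : ∀ g ∈ s, Φ (g '' L) = Φ L) :
    CC (∑ g ∈ s, g '' L) ∧ (∑ g ∈ s, g '' L).Nonempty ∧ Φ (∑ g ∈ s, g '' L) = s.card * Φ L := by
  classical
  induction s using Finset.induction_on with
  | empty =>
    simp only [Finset.sum_empty, Finset.card_empty]
    refine ⟨CC.singleton 0, ⟨0, rfl⟩, ?_⟩
    rw [← Set.singleton_zero, h.zero]; simp
  | insert g s hg ih =>
    obtain ⟨i1, i2, i3⟩ := ih (fun g' hg' => hs g' (Finset.mem_insert_of_mem hg'))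
    rw [Finset.sum_insert hg, Finset.card_insert_of_notMem hg]
    have hc : CC (g '' L) := hL.image (g.toLinearEquiv : E →ₗ[ℝ] E)
    refine ⟨hc.add i1, (hL'.image g).add i2, ?_⟩
    rw [h.add hc i1 (hL'.image g) i2, i3, hs g (Finset.mem_insert_self _ _)]
    push_cast; ring

theorem OneVal.eq_zero [Nontrivial E] (G : Subgroup (E ≃ₗᵢ[ℝ] E))
    (htrans : ∀ x y : E, ‖x‖ = 1 → ‖y‖ = 1 → ∃ g ∈ G, g x = y)
    {Φ : Set E → ℝ} (h : OneVal Φ) (hG : ∀ g ∈ G, ∀ K, CC K → Φ (g '' K) = Φ K)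
    (hD : Φ (Metric.closedBall 0 1) = 0) {K : Set E} (hK : CC K) (hK' : K.Nonempty) : Φ K = 0 := by
  obtain ⟨r, hr0, H⟩ := averaging G htrans (fun L => CC L ∧ L.Nonempty ∧ Φ L = Φ K)
    (fun L hL => hL.1) (fun L hL => hL.2.1) (by
      rintro L ⟨h1, h2, h3⟩ s hs hsG
      obtain ⟨i1, i2, i3⟩ := h.sum_image h1 h2 s (fun g hg => hG g (hsG g hg) L h1)
      have hp : (0 : ℝ) < s.card := by exact_mod_cast hs.card_pos
      refine ⟨i1.smul _, i2.smul_set, ?_⟩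
      rw [h.homog _ i1 i2 _ (by positivity), i3, h3]
      field_simp) K ⟨hK, hK', rfl⟩
  have hball : Φ (Metric.closedBall 0 r) = 0 := by
    rcases hr0.eq_or_lt with rfl | hr
    · rw [Metric.closedBall_zero, h.zero]
    · have : Metric.closedBall (0 : E) r = r • Metric.closedBall (0 : E) 1 := by
        rw [smul_unitClosedBall_of_nonneg hr0]
      rw [this, h.homog _ ⟨isCompact_closedBall _ _, convex_closedBall _ _⟩ ⟨0, by simp⟩ _ hr, hD, mul_zero]
  by_contra hne
  obtain ⟨δ, hδ, Hc⟩ := h.cont (Metric.closedBall 0 r)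
    ⟨isCompact_closedBall _ _, convex_closedBall _ _⟩ ⟨0, by simp [hr0]⟩ |Φ K| (abs_pos.2 hne)
  obtain ⟨L, ⟨hL, hL', hLK⟩, s1, s2⟩ := H δ hδ
  have := Hc L hL hL' s2 (by
    rw [closedBall_add_closedBall hr0 hδ.le]; simpa using s1)
  rw [hLK, hball, sub_zero] at this
  exact lt_irrefl _ this
end AvgSec

section VolSec
variable {E : Type} [NormedAddCommGroup E] [InnerProductSpace ℝ E] [FiniteDimensional ℝ E]
  [MeasurableSpace E] [BorelSpace E]

/-- real-valued volume -/
noncomputable def vol (S : Set E) : ℝ := (volume S).toReal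

lemma vol_nonneg (S : Set E) : 0 ≤ vol S := ENNReal.toReal_nonneg

lemma vol_mono {S T : Set E} (hT : IsCompact T) (h : S ⊆ T) : vol S ≤ vol T :=
  ENNReal.toReal_mono hT.measure_lt_top.ne (measure_mono h)

lemma vol_union {A B : Set E} (hA : IsCompact A) (hB : IsCompact B) :
    vol (A ∪ B) + vol (A ∩ B) = vol A + vol B := by
  unfold vol
  rw [← ENNReal.toReal_add (hA.union hB).measure_lt_top.ne
    (hA.inter hB).measure_lt_top.ne, ← ENNReal.toReal_add hA.measure_lt_top.ne
    hB.measure_lt_top.ne, measure_union_add_inter A hB.isClosed.measurableSet]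

lemma vol_smul (t : ℝ) (ht : 0 ≤ t) (S : Set E) : vol (t • S) = t ^ (Module.finrank ℝ E) * vol S := by
  unfold vol
  rw [Measure.addHaar_smul, ENNReal.toReal_mul, ENNReal.toReal_ofReal (abs_nonneg _),
    abs_of_nonneg (by positivity)]

lemma vol_trans (S : Set E) (x : E) : vol (S + {x}) = vol S := by
  unfold vol
  rw [Set.add_singleton]
  simp

lemma vol_isometry (g : E ≃ₗᵢ[ℝ] E) (S : Set E) : vol (g '' S) = vol S := by
  unfold vol
  have h := (g.measurePreserving).measure_preimage_equiv (f := g.toHomeomorph.toMeasurableEquiv) (g '' S)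
  rw [← h]
  congr 2
  exact (Set.preimage_image_eq S g.injective)

/-- segment `[a,b] • v` -/
def sg (v : E) (a b : ℝ) : Set E := (LinearMap.toSpanSingleton ℝ E v) '' Set.Icc a b

lemma mem_sg {v x : E} {a b : ℝ} : x ∈ sg v a b ↔ ∃ c, a ≤ c ∧ c ≤ b ∧ c • v = x := by
  simp [sg, and_assoc]

lemma sg_CC (v : E) (a b : ℝ) : CC (sg v a b) :=
  CC.image (⟨isCompact_Icc, convex_Icc a b⟩ : CC (Set.Icc a b)) _

lemma sg_shift (v : E) (a b c : ℝ) : sg v (a + c) (b + c) = sg v a b + {c • v} := by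
  rw [Set.add_singleton]
  ext x
  simp only [Set.mem_image, mem_sg]
  constructor
  · rintro ⟨d, h1, h2, rfl⟩
    exact ⟨(d - c) • v, ⟨d - c, by linarith, by linarith, rfl⟩, by rw [← add_smul]; simp⟩
  · rintro ⟨_, ⟨d, h1, h2, rfl⟩, rfl⟩
    exact ⟨d + c, by linarith, by linarith, by rw [add_smul]⟩

lemma sg_smul (v : E) (t : ℝ) : t • sg v (-1) 1 = sg (t • v) (-1) 1 := by
  ext x
  simp only [Set.mem_smul_set, mem_sg]
  constructor
  · rintro ⟨_, ⟨c, h1, h2, rfl⟩, rfl⟩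
    exact ⟨c, h1, h2, smul_comm _ _ _⟩
  · rintro ⟨c, h1, h2, rfl⟩
    exact ⟨_, ⟨c, h1, h2, rfl⟩, smul_comm _ _ _⟩

lemma sg_smul' (v : E) {t : ℝ} (ht : 0 ≤ t) : t • sg v (-1) 1 = sg v (-t) t := by
  ext x
  simp only [Set.mem_smul_set, mem_sg]
  constructor
  · rintro ⟨_, ⟨c, h1, h2, rfl⟩, rfl⟩
    exact ⟨t * c, by nlinarith, by nlinarith, by rw [mul_smul]⟩
  · rintro ⟨c, h1, h2, rfl⟩
    rcases ht.eq_or_lt with rfl | ht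
    · have : c = 0 := by linarith
      subst this
      exact ⟨0, ⟨0, by norm_num, by norm_num, by simp⟩, by simp⟩
    · refine ⟨_, ⟨c / t, ?_, ?_, rfl⟩, ?_⟩
      · rw [le_div_iff₀ ht]; linarith
      · rw [div_le_iff₀ ht]; linarith
      · rw [smul_smul]; congr 1; field_simp

lemma sg_nonempty (v : E) {a b : ℝ} (h : a ≤ b) : (sg v a b).Nonempty :=
  (Set.nonempty_Icc.2 h).image _

lemma cauchy_pos (f : ℝ → ℝ) (hadd : ∀ s t, 0 ≤ s → 0 ≤ t → f (s + t) = f s + f t)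
    (hpos : ∀ s, 0 ≤ s → 0 ≤ f s) (t : ℝ) (ht : 0 ≤ t) : f t = t * f 1 := by
  have hnat : ∀ (k : ℕ) s, 0 ≤ s → f (k * s) = k * f s := by
    intro k s hs
    induction k with
    | zero =>
      have := hadd 0 0 le_rfl le_rfl
      simp at this ⊢
      exact this
    | succ k ih =>
      push_cast
      rw [add_mul, one_mul, hadd _ _ (by positivity) hs, ih]; ring
  have hmono : ∀ s t, 0 ≤ s → s ≤ t → f s ≤ f t := by
    intro s t hs hst
    have := hadd s (t - s) hs (by linarith)
    rw [add_sub_cancel] at this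
    linarith [hpos (t - s) (by linarith)]
  have hb : ∀ k : ℕ, |k * (f t - t * f 1)| ≤ f 1 := by
    intro k
    have hk : 0 ≤ (k : ℝ) * t := by positivity
    have h1 := hmono (⌊(k : ℝ) * t⌋₊ * 1) (k * t) (by positivity) (by rw [mul_one]; exact Nat.floor_le hk)
    have h2 := hmono (k * t) ((⌊(k : ℝ) * t⌋₊ + 1 : ℕ) * 1) hk (by
      rw [mul_one]; push_cast; exact (Nat.lt_floor_add_one _).le)
    rw [hnat _ _ zero_le_one] at h1 h2
    rw [hnat _ _ ht] at h1 h2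
    have h3 := Nat.floor_le hk
    have h4 := Nat.lt_floor_add_one ((k : ℝ) * t)
    have h5 := hpos 1 zero_le_one
    push_cast at h2
    rw [abs_le]
    constructor <;> nlinarith
  by_contra hne
  have hd : 0 < |f t - t * f 1| := abs_pos.2 (sub_ne_zero.2 hne)
  obtain ⟨k, hk⟩ := exists_nat_gt (f 1 / |f t - t * f 1|)
  rw [div_lt_iff₀ hd] at hk
  have := hb k
  rw [abs_mul, Nat.abs_cast] at this
  linarith

lemma vol_add_sg {M : Set E} (hM : CC M) (v : E) {t : ℝ} (ht : 0 ≤ t) :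
    vol (M + t • sg v (-1) 1) = vol M + t * (vol (M + sg v (-1) 1) - vol M) := by
  set f : ℝ → ℝ := fun s => vol (M + sg v 0 s) - vol M with hf
  have htr : ∀ a b c : ℝ, vol (M + sg v (a + c) (b + c)) = vol (M + sg v a b) := by
    intro a b c
    rw [sg_shift, ← add_assoc, vol_trans]
  have h0 : sg v 0 0 = {0} := by
    ext x
    simp only [mem_sg, Set.mem_singleton_iff]
    constructor
    · rintro ⟨c, h1, h2, rfl⟩
      have : c = 0 := le_antisymm h2 h1
      simp [this]
    · rintro rfl
      exact ⟨0, le_rfl, le_rfl, by simp⟩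
  have hadd : ∀ s t, 0 ≤ s → 0 ≤ t → f (s + t) = f s + f t := by
    intro s t hs ht
    have c1 : CC (Set.Icc 0 s) := ⟨isCompact_Icc, convex_Icc _ _⟩
    have c2 : CC (Set.Icc s (s + t)) := ⟨isCompact_Icc, convex_Icc _ _⟩
    have hu : Set.Icc 0 s ∪ Set.Icc s (s + t) = Set.Icc 0 (s + t) :=
      Set.Icc_union_Icc_eq_Icc hs (by linarith)
    have hi : Set.Icc 0 s ∩ Set.Icc s (s + t) = Set.Icc s s := by
      rw [Set.Icc_inter_Icc]
      congr 1
      · exact max_eq_right hs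
      · exact min_eq_left (by linarith)
    have e1 := image_inter_add c1 c2 hM.2 (by rw [hu]; exact convex_Icc _ _)
      (LinearMap.toSpanSingleton ℝ E v)
    have e2 := vol_union ((sg_CC v 0 s).add hM).1 ((sg_CC v s (s + t)).add hM).1
    have e3 : sg v 0 s + M ∪ (sg v s (s + t) + M) = sg v 0 (s + t) + M := by
      rw [← Set.union_add]
      unfold sg
      rw [← Set.image_union, hu]
    rw [e3] at e2
    unfold sg at e2
    rw [← e1, hi] at e2
    change vol (sg v 0 (s + t) + M) + vol (sg v s s + M) = vol (sg v 0 s + M) + vol (sg v s (s + t) + M) at e2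
    rw [add_comm _ M, add_comm _ M, add_comm _ M, add_comm _ M] at e2
    have e4 := htr 0 0 s
    have e5 := htr 0 t s
    rw [zero_add] at e4 e5
    rw [add_comm t s] at e5
    rw [h0, vol_trans] at e4
    simp only [hf]
    linarith
  have hpos : ∀ s, 0 ≤ s → 0 ≤ f s := by
    intro s hs
    have : vol M ≤ vol (M + sg v 0 s) := vol_mono (hM.add (sg_CC v 0 s)).1
      (Set.subset_add_left M (mem_sg.2 ⟨0, le_rfl, hs, by simp⟩))
    simp only [hf]; linarith
  have hc := cauchy_pos f hadd hpos
  have e1 := htr 0 (2 * t) (-t)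
  have e2 := htr 0 2 (-1)
  have e3 := hc (2 * t) (by positivity)
  have e4 := hc 2 (by positivity)
  rw [sg_smul' v ht]
  have q1 : 2 * t + -t = t := by ring
  have q2 : (2 : ℝ) + -1 = 1 := by norm_num
  rw [zero_add, q1] at e1
  rw [zero_add, q2] at e2
  rw [e1, e2]
  simp only [hf] at e3 e4
  linear_combination e3 - t * e4

/-- zonotopes -/
inductive Zon : Set E → Prop
  | zero : Zon {0}
  | add (Z : Set E) (v : E) : Zon Z → Zon (Z + sg v (-1) 1)

lemma Zon.CC {Z : Set E} (h : Zon Z) : CC Z := by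
  induction h with
  | zero => exact CC.singleton 0
  | add Z v _ ih => exact ih.add (sg_CC v _ _)

lemma Zon.nonempty {Z : Set E} (h : Zon Z) : Z.Nonempty := by
  induction h with
  | zero => exact ⟨0, rfl⟩
  | add Z v _ ih => exact ih.add (sg_nonempty v (by norm_num))

lemma Zon.sum {Z W : Set E} (h : Zon Z) (h' : Zon W) : Zon (Z + W) := by
  induction h' with
  | zero => simpa using h
  | add W v _ ih => rw [← add_assoc]; exact ih.add _ v

lemma Zon.smul {Z : Set E} (h : Zon Z) (t : ℝ) : Zon (t • Z) := by
  induction h with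
  | zero => simpa using Zon.zero
  | add W v _ ih => rw [smul_add, sg_smul]; exact ih.add _ _

lemma Zon.image {Z : Set E} (h : Zon Z) (g : E ≃ₗᵢ[ℝ] E) : Zon (g '' Z) := by
  induction h with
  | zero => simpa using Zon.zero
  | add W v _ ih =>
    rw [Set.image_add]
    have : g '' sg v (-1) 1 = sg (g v) (-1) 1 := by
      ext x
      simp only [Set.mem_image, mem_sg]
      constructor
      · rintro ⟨_, ⟨c, h1, h2, rfl⟩, rfl⟩
        exact ⟨c, h1, h2, by simp⟩
      · rintro ⟨c, h1, h2, rfl⟩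
        exact ⟨_, ⟨c, h1, h2, rfl⟩, by simp⟩
    rw [this]
    exact ih.add _ _

lemma Zon.finsum {ι : Type*} (s : Finset ι) (Z : ι → Set E) (h : ∀ i ∈ s, Zon (Z i)) :
    Zon (∑ i ∈ s, Z i) := by
  classical
  induction s using Finset.induction_on with
  | empty => rw [Finset.sum_empty, ← Set.singleton_zero]; exact Zon.zero
  | insert i s hi ih =>
    rw [Finset.sum_insert hi]
    exact (h i (Finset.mem_insert_self _ _)).sum (ih (fun j hj => h j (Finset.mem_insert_of_mem hj)))

lemma Zon.poly {Z : Set E} (h : Zon Z) : ∀ K : Set E, _root_.CC K →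
    ∃ P : Polynomial ℝ, ∀ ε : ℝ, 0 ≤ ε → vol (K + ε • Z) = P.eval ε := by
  induction h with
  | zero => exact fun K _ => ⟨Polynomial.C (vol K), fun ε _ => by simp⟩
  | add Z v hZ ih =>
    intro K hK
    obtain ⟨P, hP⟩ := ih K hK
    obtain ⟨Q, hQ⟩ := ih (K + sg v (-1) 1) (hK.add (sg_CC v _ _))
    refine ⟨P + Polynomial.X * (Q - P), fun ε hε => ?_⟩
    rw [smul_add, ← add_assoc, vol_add_sg (hK.add (hZ.CC.smul ε)) v hε, hP ε hε]
    have : K + ε • Z + sg v (-1) 1 = K + sg v (-1) 1 + ε • Z := by abel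
    rw [this, hQ ε hε]
    simp
end VolSec

section SteinerSec
variable {E : Type} [NormedAddCommGroup E] [InnerProductSpace ℝ E] [FiniteDimensional ℝ E]
  [MeasurableSpace E] [BorelSpace E]

lemma ball_CC (r : ℝ) : CC (Metric.closedBall (0 : E) r) :=
  ⟨isCompact_closedBall _ _, convex_closedBall _ _⟩

lemma cball_add {r s : ℝ} (hr : 0 ≤ r) (hs : 0 ≤ s) :
    Metric.closedBall (0 : E) r + Metric.closedBall (0 : E) s = Metric.closedBall (0 : E) (r + s) := by
  rw [closedBall_add_closedBall hr hs, add_zero]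

lemma cball_smul {r t : ℝ} (ht : 0 ≤ t) (hr : 0 ≤ r) :
    t • Metric.closedBall (0 : E) r = Metric.closedBall (0 : E) (t * r) := by
  rw [← smul_unitClosedBall_of_nonneg hr, ← smul_unitClosedBall_of_nonneg (mul_nonneg ht hr), smul_smul]

lemma vol_ball {r : ℝ} (hr : 0 ≤ r) : vol (Metric.closedBall (0 : E) r) =
    r ^ (Module.finrank ℝ E) * vol (Metric.closedBall (0 : E) 1) := by
  rw [← smul_unitClosedBall_of_nonneg hr, vol_smul r hr]

lemma Zon.poly_degree {Z K : Set E} (hZ : Zon Z) (hK : _root_.CC K) {P : Polynomial ℝ}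
    (hP : ∀ ε : ℝ, 0 ≤ ε → vol (K + ε • Z) = P.eval ε) :
    P.degree < (Module.finrank ℝ E + 1 : ℕ) := by
  set d := Module.finrank ℝ E with hd
  by_contra hcon
  have hdeg : (Polynomial.X ^ d : Polynomial ℝ).degree < P.degree := by
    rw [Polynomial.degree_X_pow]
    refine lt_of_lt_of_le ?_ (not_lt.1 hcon)
    exact_mod_cast Nat.lt_succ_self d
  have ht := Polynomial.abs_div_tendsto_atTop_atTop_of_degree_gt P (Polynomial.X ^ d) hdeg
    (pow_ne_zero _ Polynomial.X_ne_zero)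
  obtain ⟨R, hR0, hR⟩ := (hK.1.union hZ.CC.1).isBounded.subset_closedBall_lt 0 0
  have hev := ht.eventually_gt_atTop ((2 * R) ^ d * vol (Metric.closedBall (0 : E) 1))
  obtain ⟨ε, h1, h2⟩ := (hev.and (eventually_ge_atTop 1)).exists
  have hε0 : 0 ≤ ε := by linarith
  rw [← hP ε hε0] at h1
  have hsub : K + ε • Z ⊆ Metric.closedBall 0 (2 * R * ε) := by
    rintro _ ⟨k, hk, _, ⟨z, hz, rfl⟩, rfl⟩
    have a1 := hR (Or.inl hk)
    have a2 := hR (Or.inr hz)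
    rw [mem_closedBall_zero_iff] at a1 a2 ⊢
    calc ‖k + ε • z‖ ≤ ‖k‖ + ‖ε • z‖ := norm_add_le _ _
      _ ≤ R + ε * R := by
          rw [norm_smul, Real.norm_eq_abs, abs_of_nonneg hε0]; gcongr
      _ ≤ 2 * R * ε := by nlinarith
  have hv := vol_mono (isCompact_closedBall _ _) hsub
  rw [vol_ball (by positivity), mul_pow] at hv
  simp only [Polynomial.eval_pow, Polynomial.eval_X] at h1
  rw [abs_of_nonneg (div_nonneg (vol_nonneg _) (by positivity)), lt_div_iff₀ (by positivity)] at h1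
  rw [← hd] at hv
  nlinarith

lemma exists_zonotope [Nontrivial E] (G : Subgroup (E ≃ₗᵢ[ℝ] E))
    (htrans : ∀ x y : E, ‖x‖ = 1 → ‖y‖ = 1 → ∃ g ∈ G, g x = y) (δ : ℝ) (hδ : 0 < δ) :
    ∃ Z : Set E, Zon Z ∧ Metric.closedBall 0 1 ⊆ Z ∧ Z ⊆ Metric.closedBall 0 ((1 + δ) ^ 2) := by
  obtain ⟨r, hr0, H⟩ := averaging G htrans (fun L => Zon L ∧ Metric.closedBall 0 1 ⊆ L)
    (fun L hL => hL.1.CC) (fun L hL => hL.1.nonempty) (by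
      rintro L ⟨h1, h2⟩ s hs hsG
      have hp : (0 : ℝ) < s.card := by exact_mod_cast hs.card_pos
      refine ⟨(Zon.finsum s _ (fun g _ => h1.image g)).smul _, fun x hx => ?_⟩
      refine ⟨∑ g ∈ s, x, (Set.mem_finsetSum _ _ _).2 ⟨fun _ => x, fun {g} _ => ?_, rfl⟩, ?_⟩
      · refine ⟨g.symm x, h2 ?_, g.apply_symm_apply x⟩
        rw [mem_closedBall_zero_iff] at hx ⊢
        rwa [g.symm.norm_map]
      · simp only [Finset.sum_const]
        rw [← Nat.cast_smul_eq_nsmul ℝ, smul_smul, inv_mul_cancel₀ hp.ne', one_smul])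
    (∑ i, sg (stdOrthonormalBasis ℝ E i) (-1) 1) (by
      refine ⟨Zon.finsum _ _ (fun i _ => ?_), fun x hx => ?_⟩
      · have := Zon.zero.add {0} (stdOrthonormalBasis ℝ E i)
        simpa using this
      · refine (Set.mem_finsetSum _ _ _).2 ⟨_, fun {i} _ => mem_sg.2
          ⟨inner ℝ (stdOrthonormalBasis ℝ E i) x, ?_, ?_, rfl⟩, (stdOrthonormalBasis ℝ E).sum_repr' x⟩
        all_goals
          have h1 := abs_real_inner_le_norm (stdOrthonormalBasis ℝ E i) x
          rw [(stdOrthonormalBasis ℝ E).norm_eq_one, one_mul] at h1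
          rw [mem_closedBall_zero_iff] at hx
          have := abs_le.1 (h1.trans hx)
        · exact this.1
        · exact this.2)
  obtain ⟨e0, he0⟩ : ∃ e : E, ‖e‖ = 1 := by
    obtain ⟨x, hx⟩ := exists_ne (0 : E)
    exact ⟨‖x‖⁻¹ • x, by rw [norm_smul, norm_inv, norm_norm, inv_mul_cancel₀ (norm_ne_zero_iff.2 hx)]⟩
  have hr1 : 1 ≤ r := by
    by_contra! hlt
    obtain ⟨L, ⟨_, h1⟩, h2, _⟩ := H ((1 - r) / 2) (by linarith)
    have := h2 (h1 (by rw [mem_closedBall_zero_iff, he0] : e0 ∈ _))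
    rw [mem_closedBall_zero_iff, he0] at this
    linarith
  obtain ⟨L, ⟨hL, h1⟩, h2, h3⟩ := H δ hδ
  have hrp : 0 < r := by linarith
  refine ⟨((1 + δ) / r) • L, hL.smul _, ?_, ?_⟩
  · have s1 : Metric.closedBall (0 : E) r ⊆ (1 + δ) • L := by
      rw [hL.CC.2.add_smul zero_le_one hδ.le, one_smul]
      refine h3.trans (Set.add_subset_add_left ?_)
      rw [← smul_unitClosedBall_of_nonneg hδ.le]
      exact Set.smul_set_mono h1
    have s2 := Set.smul_set_mono (a := r⁻¹) s1
    rw [cball_smul (by positivity) hr0, inv_mul_cancel₀ hrp.ne', smul_smul] at s2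
    rwa [div_eq_inv_mul]
  · refine (Set.smul_set_mono h2).trans ?_
    rw [cball_smul (by positivity) (by positivity)]
    apply Metric.closedBall_subset_closedBall
    rw [div_mul_eq_mul_div, div_le_iff₀ hrp]
    have : (0:ℝ) ≤ (1 + δ) * δ * (r - 1) := mul_nonneg (by positivity) (by linarith)
    nlinarith

/-- the Steiner polynomial by interpolation -/
noncomputable def steinerP (S : Set E) : Polynomial ℝ :=
  Lagrange.interpolate (Finset.range (Module.finrank ℝ E + 1)) (fun i : ℕ => (i : ℝ) + 1)
    (fun i : ℕ => vol (S + Metric.closedBall 0 ((i : ℝ) + 1)))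

lemma steiner_aux [Nontrivial E] (G : Subgroup (E ≃ₗᵢ[ℝ] E))
    (htrans : ∀ x y : E, ‖x‖ = 1 → ‖y‖ = 1 → ∃ g ∈ G, g x = y) {K : Set E} (hK : CC K)
    (h0 : (0 : E) ∈ K) {ε : ℝ} (hε : 0 ≤ ε) :
    vol (K + Metric.closedBall 0 ε) = (steinerP K).eval ε := by
  set d := Module.finrank ℝ E with hd
  have hδ : ∀ k : ℕ, (0 : ℝ) < 1 / ((k : ℝ) + 1) := fun k => by positivity
  choose Z hZ hZ1 hZ2 using fun k : ℕ => exists_zonotope G htrans (1 / ((k : ℝ) + 1)) (hδ k)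
  choose P hP using fun k => (hZ k).poly K hK
  have hPdeg : ∀ k, (P k).degree < (d + 1 : ℕ) := fun k => (hZ k).poly_degree hK (hP k)
  have hlim : ∀ e : ℝ, 0 ≤ e → Tendsto (fun k => (P k).eval e) atTop (𝓝 (vol (K + Metric.closedBall 0 e))) := by
    intro e he
    have hlow : ∀ k, vol (K + Metric.closedBall 0 e) ≤ (P k).eval e := by
      intro k
      rw [← hP k e he]
      apply vol_mono (hK.add ((hZ k).CC.smul e)).1
      rw [← smul_unitClosedBall_of_nonneg he]
      exact Set.add_subset_add_left (Set.smul_set_mono (hZ1 k))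
    have hup : ∀ k : ℕ, (P k).eval e ≤ ((1 + 1 / ((k : ℝ) + 1)) ^ 2) ^ d * vol (K + Metric.closedBall 0 e) := by
      intro k
      set c := (1 + 1 / ((k : ℝ) + 1)) ^ 2 with hc
      have hc1 : 1 ≤ c := by
        have := hδ k
        rw [hc]; nlinarith
      rw [← hP k e he, ← vol_smul c (by linarith)]
      apply vol_mono ((hK.add (ball_CC e)).smul c).1
      rw [smul_add]
      refine Set.add_subset_add ?_ ?_
      · intro x hx
        refine ⟨c⁻¹ • x, ?_, by simp only; rw [smul_smul, mul_inv_cancel₀ (by linarith), one_smul]⟩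
        exact hK.2.smul_mem_of_zero_mem h0 hx ⟨by positivity, inv_le_one_of_one_le₀ hc1⟩
      · refine (Set.smul_set_mono (hZ2 k)).trans ?_
        rw [cball_smul he (by positivity), cball_smul (by positivity) he, mul_comm]
    have hone : Tendsto (fun k : ℕ => ((1 + 1 / ((k : ℝ) + 1)) ^ 2) ^ d * vol (K + Metric.closedBall 0 e))
        atTop (𝓝 (vol (K + Metric.closedBall 0 e))) := by
      have := ((((tendsto_one_div_add_atTop_nhds_zero_nat (𝕜 := ℝ)).const_add 1).pow 2).pow d).mul_const
        (vol (K + Metric.closedBall 0 e))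
      simpa using this
    exact tendsto_of_tendsto_of_tendsto_of_le_of_le tendsto_const_nhds hone hlow hup
  have hinj : Set.InjOn (fun i : ℕ => (i : ℝ) + 1) (Finset.range (d + 1)) := by
    intro a _ b _ hab
    simpa using hab
  have hint : ∀ k, (P k).eval ε = ∑ i ∈ Finset.range (d + 1), (P k).eval ((i : ℝ) + 1) *
      (Lagrange.basis (Finset.range (d + 1)) (fun i : ℕ => (i : ℝ) + 1) i).eval ε := by
    intro k
    have := Lagrange.eq_interpolate (f := P k) hinj (by simpa using hPdeg k)
    conv_lhs => rw [this, Lagrange.interpolate_apply, Polynomial.eval_finsetSum]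
    simp
  have l1 := hlim ε hε
  have l2 : Tendsto (fun k => (P k).eval ε) atTop (𝓝 ((steinerP K).eval ε)) := by
    simp only [hint]
    unfold steinerP
    rw [Lagrange.interpolate_apply, Polynomial.eval_finsetSum]
    apply tendsto_finsetSum
    intro i _
    rw [Polynomial.eval_mul, Polynomial.eval_C]
    exact (hlim _ (by positivity)).mul_const _
  exact tendsto_nhds_unique l1 l2

lemma steinerP_trans (K : Set E) (x : E) : steinerP (K + {x}) = steinerP K := by
  unfold steinerP
  congr 1
  ext i
  rw [add_right_comm, vol_trans]

lemma steiner [Nontrivial E] (G : Subgroup (E ≃ₗᵢ[ℝ] E))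
    (htrans : ∀ x y : E, ‖x‖ = 1 → ‖y‖ = 1 → ∃ g ∈ G, g x = y) {K : Set E} (hK : CC K)
    (hne : K.Nonempty) {ε : ℝ} (hε : 0 ≤ ε) :
    vol (K + Metric.closedBall 0 ε) = (steinerP K).eval ε := by
  obtain ⟨x, hx⟩ := hne
  have := steiner_aux G htrans (hK.add (CC.singleton (-x))) ⟨x, hx, -x, rfl, by simp⟩ hε
  rwa [steinerP_trans, add_right_comm, vol_trans] at this

lemma poly_unique {P Q : Polynomial ℝ} (h : ∀ ε : ℝ, 0 ≤ ε → P.eval ε = Q.eval ε) : P = Q :=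
  Polynomial.eq_of_infinite_eval_eq P Q ((Set.Ici_infinite (0 : ℝ)).mono (fun x hx => h x hx))
end SteinerSec

section PhiVSec
variable {E : Type} [NormedAddCommGroup E] [InnerProductSpace ℝ E] [FiniteDimensional ℝ E]
  [MeasurableSpace E] [BorelSpace E]

/-- the coefficient of degree `n-1` of the Steiner polynomial -/
noncomputable def phiV (S : Set E) : ℝ := (steinerP S).coeff (Module.finrank ℝ E - 1)

/-- interpolation weights -/
noncomputable def wt (d i : ℕ) : ℝ :=
  (Lagrange.basis (Finset.range (d + 1)) (fun i : ℕ => (i : ℝ) + 1) i).coeff (d - 1)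

lemma phiV_eq (S : Set E) : phiV S = ∑ i ∈ Finset.range (Module.finrank ℝ E + 1),
    wt (Module.finrank ℝ E) i * vol (S + Metric.closedBall 0 ((i : ℝ) + 1)) := by
  unfold phiV steinerP wt
  rw [Lagrange.interpolate_apply, Polynomial.finsetSum_coeff]
  refine Finset.sum_congr rfl (fun i _ => ?_)
  rw [Polynomial.coeff_C_mul, mul_comm]

lemma vol_cont [Nontrivial E] (G : Subgroup (E ≃ₗᵢ[ℝ] E))
    (htrans : ∀ x y : E, ‖x‖ = 1 → ‖y‖ = 1 → ∃ g ∈ G, g x = y) {K : Set E} (hK : CC K)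
    (hne : K.Nonempty) {j : ℝ} (hj : 1 ≤ j) {ε : ℝ} (hε : 0 < ε) :
    ∀ᶠ δ in 𝓝[>] (0 : ℝ), ∀ K', CC K' → K ⊆ K' + Metric.closedBall 0 δ →
      K' ⊆ K + Metric.closedBall 0 δ →
      |vol (K' + Metric.closedBall 0 j) - vol (K + Metric.closedBall 0 j)| ≤ ε := by
  have hc : Continuous (fun x : ℝ => (steinerP K).eval x) := (steinerP K).continuous
  obtain ⟨η, hη, H⟩ := Metric.continuous_iff.1 hc j ε hε
  have hev : ∀ᶠ δ in 𝓝[>] (0 : ℝ), δ ∈ Set.Ioo (0 : ℝ) (min η 1) :=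
    Ioo_mem_nhdsGT (lt_min hη one_pos)
  filter_upwards [hev] with δ hδ K' hK' s1 s2
  obtain ⟨hδ0, hδ1⟩ := hδ
  have hδη : δ < η := hδ1.trans_le (min_le_left _ _)
  have hδ1' : δ < 1 := hδ1.trans_le (min_le_right _ _)
  have u1 : vol (K' + Metric.closedBall 0 j) ≤ vol (K + Metric.closedBall 0 (j + δ)) := by
    apply vol_mono (hK.add (ball_CC _)).1
    rw [add_comm j δ, ← cball_add hδ0.le (by linarith), ← add_assoc]
    exact Set.add_subset_add_right s2
  have u2 : vol (K + Metric.closedBall 0 (j - δ)) ≤ vol (K' + Metric.closedBall 0 j) := by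
    apply vol_mono (hK'.add (ball_CC _)).1
    have : Metric.closedBall (0 : E) j = Metric.closedBall 0 δ + Metric.closedBall 0 (j - δ) := by
      rw [cball_add hδ0.le (by linarith)]; congr 1; ring
    rw [this, ← add_assoc]
    exact Set.add_subset_add_right s1
  rw [steiner G htrans hK hne (by linarith)] at u1 u2
  rw [steiner G htrans hK hne (by linarith : 0 ≤ j)]
  have v1 := H (j + δ) (by rw [Real.dist_eq, add_sub_cancel_left, abs_of_pos hδ0]; exact hδη)
  have v2 := H (j - δ) (by rw [Real.dist_eq, sub_sub_cancel_left, abs_neg, abs_of_pos hδ0]; exact hδη)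
  rw [Real.dist_eq, abs_lt] at v1 v2
  rw [abs_le]
  constructor <;> linarith

lemma phiV_oneVal [Nontrivial E] (G : Subgroup (E ≃ₗᵢ[ℝ] E))
    (htrans : ∀ x y : E, ‖x‖ = 1 → ‖y‖ = 1 → ∃ g ∈ G, g x = y) : OneVal (phiV : Set E → ℝ) := by
  have hd : 0 < Module.finrank ℝ E := Module.finrank_pos
  refine ⟨?_, ?_, ?_, ?_, ?_, ?_⟩
  · rw [phiV_eq]; simp [vol]
  · have : steinerP ({0} : Set E) = Polynomial.C (vol (Metric.closedBall (0 : E) 1)) *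
        Polynomial.X ^ (Module.finrank ℝ E) := by
      apply poly_unique
      intro ε hε
      rw [← steiner G htrans (CC.singleton 0) ⟨0, rfl⟩ hε, Set.singleton_zero, zero_add, vol_ball hε,
        Polynomial.eval_mul, Polynomial.eval_C, Polynomial.eval_pow, Polynomial.eval_X, mul_comm]
    unfold phiV
    rw [this, Polynomial.coeff_C_mul_X_pow, if_neg (by omega)]
  · intro K L hK hL hU
    simp only [phiV_eq]
    rw [← Finset.sum_add_distrib, ← Finset.sum_add_distrib]
    refine Finset.sum_congr rfl (fun i _ => ?_)
    rw [← mul_add, ← mul_add]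
    congr 1
    have e2 : (K ∩ L) + Metric.closedBall 0 ((i : ℝ) + 1) = (K + Metric.closedBall 0 ((i : ℝ) + 1)) ∩
        (L + Metric.closedBall 0 ((i : ℝ) + 1)) := by
      simpa only [LinearMap.id_coe, Set.image_id] using
        image_inter_add hK hL (ball_CC ((i : ℝ) + 1)).2 hU (LinearMap.id : E →ₗ[ℝ] E)
    rw [e2, Set.union_add]
    exact vol_union (hK.add (ball_CC _)).1 (hL.add (ball_CC _)).1
  · intro K _ x
    unfold phiV
    rw [steinerP_trans]
  · intro K hK hne t ht
    have : steinerP (t • K) = Polynomial.C (t ^ (Module.finrank ℝ E)) *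
        (steinerP K).comp (Polynomial.C t⁻¹ * Polynomial.X) := by
      apply poly_unique
      intro ε hε
      have h1 : Metric.closedBall (0 : E) ε = t • Metric.closedBall (0 : E) (t⁻¹ * ε) := by
        rw [cball_smul ht.le (by positivity)]; congr 1; field_simp
      rw [← steiner G htrans (hK.smul t) hne.smul_set hε, h1, ← smul_add, vol_smul t ht.le,
        steiner G htrans hK hne (by positivity)]
      simp
    unfold phiV
    rw [this, Polynomial.coeff_C_mul, Polynomial.comp_C_mul_X_coeff]
    obtain ⟨m, hm⟩ : ∃ m, Module.finrank ℝ E = m + 1 := ⟨_, (Nat.succ_pred_eq_of_pos hd).symm⟩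
    rw [hm, Nat.add_sub_cancel, pow_succ, inv_pow]
    have := pow_ne_zero m ht.ne'
    field_simp
  · intro K hK hne ε hε
    set W := ∑ i ∈ Finset.range (Module.finrank ℝ E + 1), |wt (Module.finrank ℝ E) i| with hW
    have hW0 : 0 ≤ W := Finset.sum_nonneg (fun _ _ => abs_nonneg _)
    have hev : ∀ᶠ δ in 𝓝[>] (0 : ℝ), ∀ i ∈ Finset.range (Module.finrank ℝ E + 1),
        ∀ K', CC K' → K ⊆ K' + Metric.closedBall 0 δ → K' ⊆ K + Metric.closedBall 0 δ →
      |vol (K' + Metric.closedBall 0 ((i : ℝ) + 1)) - vol (K + Metric.closedBall 0 ((i : ℝ) + 1))|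
        ≤ ε / (W + 1) := by
      rw [Filter.eventually_all_finset]
      intro i _
      exact vol_cont G htrans hK hne (by linarith [(Nat.cast_nonneg i : (0 : ℝ) ≤ i)]) (by positivity)
    obtain ⟨δ, h1, h2⟩ := (hev.and self_mem_nhdsWithin).exists
    refine ⟨δ, h2, fun K' hK' _ s1 s2 => ?_⟩
    rw [phiV_eq, phiV_eq, ← Finset.sum_sub_distrib]
    calc _ ≤ ∑ i ∈ Finset.range (Module.finrank ℝ E + 1), |wt (Module.finrank ℝ E) i| * (ε / (W + 1)) := by
          refine (Finset.abs_sum_le_sum_abs _ _).trans (Finset.sum_le_sum (fun i hi => ?_))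
          rw [← mul_sub, abs_mul]
          gcongr
          exact h1 i hi K' hK' s1 s2
      _ = W * (ε / (W + 1)) := by rw [← Finset.sum_mul]
      _ < ε := by
          rw [mul_div_assoc', div_lt_iff₀ (by positivity)]
          nlinarith

lemma phiV_image (g : E ≃ₗᵢ[ℝ] E) (K : Set E) : phiV (g '' K) = phiV K := by
  rw [phiV_eq, phiV_eq]
  refine Finset.sum_congr rfl (fun i _ => ?_)
  congr 1
  rw [← vol_isometry g (K + _), Set.image_add]
  congr 2
  rw [g.image_closedBall, map_zero]

lemma phiV_ball [Nontrivial E] (G : Subgroup (E ≃ₗᵢ[ℝ] E))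
    (htrans : ∀ x y : E, ‖x‖ = 1 → ‖y‖ = 1 → ∃ g ∈ G, g x = y) :
    phiV (Metric.closedBall (0 : E) 1) ≠ 0 := by
  have hd : 0 < Module.finrank ℝ E := Module.finrank_pos
  have : steinerP (Metric.closedBall (0 : E) 1) = Polynomial.C (vol (Metric.closedBall (0 : E) 1)) *
        (1 + Polynomial.X) ^ (Module.finrank ℝ E) := by
    apply poly_unique
    intro ε hε
    rw [← steiner G htrans (ball_CC 1) ⟨0, by simp⟩ hε, cball_add zero_le_one hε,
      vol_ball (by positivity)]
    simp [mul_comm]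
  unfold phiV
  rw [this, Polynomial.coeff_C_mul, Polynomial.coeff_one_add_X_pow]
  have hv : vol (Metric.closedBall (0 : E) 1) ≠ 0 := by
    unfold vol
    exact (ENNReal.toReal_pos (Metric.measure_closedBall_pos volume _ one_pos).ne'
      (isCompact_closedBall _ _).measure_lt_top.ne).ne'
  refine mul_ne_zero hv ?_
  exact_mod_cast (Nat.choose_pos (Nat.sub_le _ _)).ne'
end PhiVSec

lemma ballVol_ne (j : ℕ) : (volume (Metric.closedBall (0 : EuclideanSpace ℝ (Fin j)) 1)).toReal ≠ 0 :=
  (ENNReal.toReal_pos (Metric.measure_closedBall_pos volume _ one_pos).ne'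
      (isCompact_closedBall _ _).measure_lt_top.ne).ne'

section FinalSec
variable {E : Type} [NormedAddCommGroup E] [NormedSpace ℝ E]

open Classical in
/-- extension by zero of a functional on convex bodies to all sets -/
noncomputable def extSet (φ : ConvexBody E → ℝ) (S : Set E) : ℝ :=
  if h : CC S ∧ S.Nonempty then φ ⟨S, h.1.2, h.1.1, h.2⟩ else 0

lemma extSet_of {φ : ConvexBody E → ℝ} {S : Set E} (h : CC S) (h' : S.Nonempty) :
    extSet φ S = φ ⟨S, h.2, h.1, h'⟩ := by
  unfold extSet; rw [dif_pos ⟨h, h'⟩]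

lemma extSet_empty (φ : ConvexBody E → ℝ) : extSet φ ∅ = 0 := by
  unfold extSet; rw [dif_neg]; rintro ⟨_, h⟩; exact Set.not_nonempty_empty h

lemma extSet_oneVal {φ : ConvexBody E → ℝ}
    (hval : ∀ K L KL KI : ConvexBody E, (KL : Set E) = ↑K ∪ ↑L → (KI : Set E) = ↑K ∩ ↑L →
        φ KL = φ K + φ L - φ KI)
    (htr : ∀ (K K' : ConvexBody E) (x : E), (K' : Set E) = (fun v => v + x) '' ↑K → φ K' = φ K)
    (hcont : Continuous φ)
    (hhom : ∀ (lam : ℝ), 0 ≤ lam → ∀ K, φ (lam • K) = lam * φ K) : OneVal (extSet φ) := by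
  refine ⟨extSet_empty φ, ?_, ?_, ?_, ?_, ?_⟩
  · rw [extSet_of (CC.singleton 0) ⟨0, rfl⟩]
    have h := hhom 0 le_rfl ⟨{0}, (CC.singleton 0).2, (CC.singleton 0).1, ⟨0, rfl⟩⟩
    rw [zero_mul] at h
    rw [← h]
    congr 1
    apply SetLike.coe_injective
    rw [ConvexBody.coe_smul]
    change ({0} : Set E) = (0 : ℝ) • ({0} : Set E)
    simp
  · intro K L hK hL hU
    rcases K.eq_empty_or_nonempty with rfl | hK'
    · simp [extSet_empty]
    rcases L.eq_empty_or_nonempty with rfl | hL'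
    · simp [extSet_empty]
    obtain ⟨x, hx⟩ := hK'
    obtain ⟨y, hy⟩ := hL'
    obtain ⟨a, b, _, _, _, hm⟩ := exists_mem_inter_of_union_convex hK hL hU hx hy
    have n1 : (K ∩ L).Nonempty := ⟨_, hm⟩
    have n2 : (K ∪ L).Nonempty := ⟨x, Or.inl hx⟩
    rw [extSet_of (⟨hK.1.union hL.1, hU⟩ : CC (K ∪ L)) n2, extSet_of (hK.inter hL) n1,
      extSet_of hK ⟨x, hx⟩, extSet_of hL ⟨y, hy⟩]
    rw [hval ⟨K, hK.2, hK.1, ⟨x, hx⟩⟩ ⟨L, hL.2, hL.1, ⟨y, hy⟩⟩ ⟨K ∪ L, hU, hK.1.union hL.1, n2⟩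
      ⟨K ∩ L, (hK.inter hL).2, (hK.inter hL).1, n1⟩ rfl rfl]
    ring
  · intro K hK x
    rcases K.eq_empty_or_nonempty with rfl | hK'
    · simp
    have hc := hK.add (CC.singleton x)
    have hn : (K + {x}).Nonempty := hK'.add ⟨x, rfl⟩
    rw [extSet_of hc hn, extSet_of hK hK']
    exact htr _ _ x (Set.add_singleton)
  · intro K hK hK' t ht
    rw [extSet_of (hK.smul t) hK'.smul_set, extSet_of hK hK', ← hhom t ht.le]
    congr 1
  · intro K hK hK' ε hε
    obtain ⟨η, hη, H⟩ := Metric.continuous_iff.1 hcont ⟨K, hK.2, hK.1, hK'⟩ ε hε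
    refine ⟨η / 2, by positivity, fun K' hc hn s1 s2 => ?_⟩
    rw [extSet_of hc hn, extSet_of hK hK', ← Real.dist_eq]
    apply H
    rw [← ConvexBody.hausdorffDist_coe]
    refine lt_of_le_of_lt (Metric.hausdorffDist_le_of_mem_dist (r := η / 2) (by positivity) ?_ ?_) (by linarith)
    · intro x hx
      obtain ⟨y, hy, z, hz, rfl⟩ := s2 hx
      exact ⟨y, hy, by simpa [dist_eq_norm] using hz⟩
    · intro x hx
      obtain ⟨y, hy, z, hz, rfl⟩ := s1 hx
      exact ⟨y, hy, by simpa [dist_eq_norm] using hz⟩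
end FinalSec

end Helpers

/-- if a group `G` of linear isometries of a Euclidean space (a subgroup
of `GL(V)` preserving a Euclidean metric) acts transitively on the unit sphere, then
the space of `G`-invariant translation invariant continuous `1`-homogeneous valuations
is one-dimensional, spanned by the first intrinsic volume `V₁` (characterized via the
Steiner polynomial: `κ_{n-1} V₁(K)` is the coefficient of `ε^{n-1}` in `vol(K + εD)`). -/
theorem invariant_one_homogeneous_valuation_is_multiple_of_V1 (n : ℕ) (hn : 1 ≤ n)
    (G : Subgroup ((EuclideanSpace ℝ (Fin n)) ≃ₗᵢ[ℝ] (EuclideanSpace ℝ (Fin n))))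
    (htrans : ∀ x y : EuclideanSpace ℝ (Fin n), ‖x‖ = 1 → ‖y‖ = 1 →
      ∃ g ∈ G, g x = y)
    -- the first intrinsic volume, via the Steiner polynomial
    (V1 : ConvexBody (EuclideanSpace ℝ (Fin n)) → ℝ)
    (hV1 : ∀ (K : ConvexBody (EuclideanSpace ℝ (Fin n))) (P : Polynomial ℝ),
      (∀ ε : ℝ, 0 ≤ ε →
        (volume ((K : Set (EuclideanSpace ℝ (Fin n)))
          + ε • Metric.closedBall (0 : EuclideanSpace ℝ (Fin n)) 1)).toReal = P.eval ε) →
      V1 K = P.coeff (n - 1) / ballVol (n - 1)) :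
    ∀ φ : ConvexBody (EuclideanSpace ℝ (Fin n)) → ℝ,
      -- valuation property
      (∀ K L KL KI : ConvexBody (EuclideanSpace ℝ (Fin n)),
        (KL : Set (EuclideanSpace ℝ (Fin n))) = ↑K ∪ ↑L →
        (KI : Set (EuclideanSpace ℝ (Fin n))) = ↑K ∩ ↑L →
        φ KL = φ K + φ L - φ KI) →
      -- translation invariance
      (∀ (K K' : ConvexBody (EuclideanSpace ℝ (Fin n)))
        (x : EuclideanSpace ℝ (Fin n)),
        (K' : Set (EuclideanSpace ℝ (Fin n))) = (fun v => v + x) '' ↑K → φ K' = φ K) →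
      -- continuity in the Hausdorff metric
      Continuous φ →
      -- 1-homogeneity
      (∀ (lam : ℝ), 0 ≤ lam → ∀ K, φ (lam • K) = lam * φ K) →
      -- G-invariance
      (∀ g ∈ G, ∀ K K' : ConvexBody (EuclideanSpace ℝ (Fin n)),
        (K' : Set (EuclideanSpace ℝ (Fin n))) = g '' ↑K → φ K' = φ K) →
      ∃ c : ℝ, ∀ K, φ K = c * V1 K := by
  intro φ hval htr hcont hhom hG
  have hnt : Nontrivial (EuclideanSpace ℝ (Fin n)) :=
    Module.nontrivial_of_finrank_pos (R := ℝ) (by rw [finrank_euclideanSpace_fin]; omega)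
  have h1 : OneVal (extSet φ) := extSet_oneVal hval htr hcont hhom
  have h2 : OneVal (phiV : Set (EuclideanSpace ℝ (Fin n)) → ℝ) := phiV_oneVal G htrans
  have hD := phiV_ball G htrans
  set D : Set (EuclideanSpace ℝ (Fin n)) := Metric.closedBall 0 1 with hDdef
  set c := extSet φ D / phiV D with hc
  have h3 := h1.sub_smul h2 c
  refine ⟨c * ballVol (n - 1), fun K => ?_⟩
  have hKc : CC (K : Set (EuclideanSpace ℝ (Fin n))) := ⟨K.isCompact, K.convex⟩
  have hz := h3.eq_zero G htrans (by
    intro g hg S hS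
    have e : extSet φ (g '' S) = extSet φ S := by
      rcases S.eq_empty_or_nonempty with rfl | hS'
      · simp
      · have hgS : CC (g '' S) := hS.image (g.toLinearEquiv :
          EuclideanSpace ℝ (Fin n) →ₗ[ℝ] EuclideanSpace ℝ (Fin n))
        rw [extSet_of hS hS', extSet_of hgS (hS'.image _)]
        exact hG g hg _ _ rfl
    rw [e, phiV_image]) (by
    change extSet φ D - c * phiV D = 0
    rw [hc]; field_simp; simp) hKc K.nonempty
  have hV := hV1 K (steinerP (K : Set (EuclideanSpace ℝ (Fin n)))) (by
    intro ε hε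
    rw [← steiner G htrans hKc K.nonempty hε, ← smul_unitClosedBall_of_nonneg hε]
    rfl)
  have e1 : extSet φ (K : Set (EuclideanSpace ℝ (Fin n))) = φ K := extSet_of hKc K.nonempty
  have e2 : phiV (K : Set (EuclideanSpace ℝ (Fin n))) =
      (steinerP (K : Set (EuclideanSpace ℝ (Fin n)))).coeff (n - 1) := by
    unfold phiV; rw [finrank_euclideanSpace_fin]
  have hb : ballVol (n - 1) ≠ 0 := ballVol_ne (n - 1)
  rw [hV, ← e2]
  have e3 : φ K - c * phiV (K : Set (EuclideanSpace ℝ (Fin n))) = 0 := by rw [← e1]; exact hz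
  field_simp
  linarith
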